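/- Let p be a prime, let σ be a positive integer with 0 < |σ − p − 1| ≤ 2√p, let E : y² = x³ + Ax + B be an elliptic curve over F_p with #E(F_p) ≠ σ, let α ∈ F_p be a quadratic non-residue, and let E^t : y² = x³ + α⁻²Ax + α⁻³B be the quadratic twist of E. Suppose σ·P = 0 for every P ∈ E(F_p), (2p + 2 − σ)·Q = 0 for every Q ∈ E^t(F_p), and E(F_p) ≅ (Z/m₁Z) × (Z/m₁k₁Z) for positive integers m₁, k₁. Then k₁ > √p/8 − 1/2, m₁ < 3·p^{1/4}, and m₁k₁ > p^{3/4}/√10. -/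

import Mathlib

/-- The short Weierstrass curve `y² = x³ + Ax + B` over a field `F`. -/
def shortWeierstrass (F : Type) [Field F] (A B : F) : WeierstrassCurve.Affine F :=
  { a₁ := 0, a₂ := 0, a₃ := 0, a₄ := A, a₆ := B }

open Polynomial

theorem aux_addsub {L : Type} [Field L] [DecidableEq L] (W : WeierstrassCurve.Affine L)
    (h1 : W.a₁ = 0) (h2 : W.a₂ = 0) (h3 : W.a₃ = 0) (P Q : W.Point) :
    ∃ c : L,
      (P.xRep 0 * Q.xRep 1 - P.xRep 1 * Q.xRep 0) ^ 2 = c * ((P + Q).xRep 1 * (P - Q).xRep 1) ∧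
      2 * (P.xRep 0 * Q.xRep 1 + P.xRep 1 * Q.xRep 0) *
          (W.a₄ * (P.xRep 1 * Q.xRep 1) + P.xRep 0 * Q.xRep 0)
          + 4 * W.a₆ * (P.xRep 1 * Q.xRep 1) ^ 2
        = c * ((P + Q).xRep 0 * (P - Q).xRep 1 + (P + Q).xRep 1 * (P - Q).xRep 0) ∧
      (P.xRep 0 * Q.xRep 0 - W.a₄ * (P.xRep 1 * Q.xRep 1)) ^ 2
          - 4 * W.a₆ * (P.xRep 1 * Q.xRep 1) * (P.xRep 0 * Q.xRep 1 + P.xRep 1 * Q.xRep 0)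
        = c * ((P + Q).xRep 0 * (P - Q).xRep 0) := by
  rcases P with _ | ⟨x1, y1, hP⟩
  · rw [← WeierstrassCurve.Affine.Point.zero_def]
    refine ⟨1, ?_, ?_, ?_⟩ <;> simp <;> ring
  rcases Q with _ | ⟨x2, y2, hQ⟩
  · rw [← WeierstrassCurve.Affine.Point.zero_def]
    refine ⟨1, ?_, ?_, ?_⟩ <;> simp <;> ring
  have e1 := (W.equation_iff x1 y1).1 hP.1
  have e2 := (W.equation_iff x2 y2).1 hQ.1
  simp only [h1, h2, h3, zero_mul, add_zero] at e1 e2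
  have hneg : ∀ x y, W.negY x y = -y := by intro x y; simp [WeierstrassCurve.Affine.negY, h1, h3]
  rw [sub_eq_add_neg (WeierstrassCurve.Affine.Point.some x1 y1 hP),
    WeierstrassCurve.Affine.Point.neg_some]
  by_cases hx : x1 = x2
  · subst hx
    have hyy : (y1 - y2) * (y1 + y2) = 0 := by linear_combination e1 - e2
    by_cases ha : y1 = -y2
    · rw [WeierstrassCurve.Affine.Point.add_of_Y_eq (W := W) rfl (by rw [hneg]; exact ha)]
      by_cases hb : y1 = y2
      · rw [WeierstrassCurve.Affine.Point.add_of_Y_eq (W := W) rfl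
          (by rw [hneg, hneg, neg_neg]; exact hb)]
        refine ⟨(x1 * x1 - W.a₄) ^ 2 - 4 * W.a₆ * (x1 + x1), ?_, ?_, ?_⟩
        · simp
        · simp
          have : 2 * y1 = 0 := by linear_combination ha + hb
          linear_combination (-4) * e1 + 2 * y1 * this
        · simp
      · rw [WeierstrassCurve.Affine.Point.add_of_Y_ne (W := W)
          (by rw [hneg, hneg, neg_neg]; exact hb)]
        have hne : y1 - -y1 ≠ 0 := by
          intro h; apply hb; linear_combination h - ha
        have hl := WeierstrassCurve.Affine.slope_of_Y_ne (W := W) (x₁ := x1) (y₁ := y1) (y₂ := W.negY x1 y2) rfl (by rw [hneg, hneg, neg_neg]; exact hb)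
        set l := W.slope x1 x1 y1 (W.negY x1 y2)
        rw [hneg, eq_div_iff hne] at hl
        refine ⟨4 * y1 ^ 2, ?_, ?_, ?_⟩
        · simp
        · simp
          linear_combination (-4) * e1
        · simp only [WeierstrassCurve.Affine.Point.xRep_some, WeierstrassCurve.Affine.Point.xRep_zero, WeierstrassCurve.Affine.addX, h1, h2, Matrix.cons_val_zero, Matrix.cons_val_one]
          simp only [h1, h2] at hl
          linear_combination (-(2 * l * y1 + 3 * x1 ^ 2 + W.a₄)) * hl + 8 * x1 * e1
    · have hb : y1 = y2 := by
        rcases mul_eq_zero.1 hyy with h | h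
        · linear_combination h
        · exact absurd (by linear_combination h) ha
      subst hb
      rw [WeierstrassCurve.Affine.Point.add_of_Y_eq (W := W) (x₁ := x1) (y₂ := W.negY x1 y1) rfl
          (by rw [hneg, hneg, neg_neg])]
      rw [WeierstrassCurve.Affine.Point.add_of_Y_ne (W := W) (by rw [hneg]; exact ha)]
      have h2y : y1 + y1 ≠ 0 := by
        intro h; apply ha; linear_combination h
      have hl := WeierstrassCurve.Affine.slope_of_Y_ne (W := W) (x₁ := x1) (y₁ := y1) (y₂ := y1) rfl (by rw [hneg]; exact ha)
      set l := W.slope x1 x1 y1 y1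
      rw [hneg, eq_div_iff (by simpa using h2y)] at hl
      refine ⟨4 * y1 ^ 2, ?_, ?_, ?_⟩
      · simp
      · simp
        linear_combination (-4) * e1
      · simp only [WeierstrassCurve.Affine.Point.xRep_some, WeierstrassCurve.Affine.Point.xRep_zero, WeierstrassCurve.Affine.addX, h1, h2, Matrix.cons_val_zero, Matrix.cons_val_one]
        simp only [h1, h2] at hl
        linear_combination (-(2 * l * y1 + 3 * x1 ^ 2 + W.a₄)) * hl + 8 * x1 * e1
  · rw [WeierstrassCurve.Affine.Point.add_of_X_ne hx, WeierstrassCurve.Affine.Point.add_of_X_ne hx]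
    have hx' : x1 - x2 ≠ 0 := sub_ne_zero.2 hx
    have hl := WeierstrassCurve.Affine.slope_of_X_ne (W := W) (y₁ := y1) (y₂ := y2) hx
    have hm := WeierstrassCurve.Affine.slope_of_X_ne (W := W) (y₁ := y1) (y₂ := W.negY x2 y2) hx
    set l := W.slope x1 x2 y1 y2
    set m := W.slope x1 x2 y1 (W.negY x2 y2)
    rw [eq_div_iff hx'] at hl
    rw [hneg, eq_div_iff hx'] at hm
    have hlm : l * m * (x1 - x2) = x1 ^ 2 + x1 * x2 + x2 ^ 2 + W.a₄ := by
      apply mul_right_cancel₀ hx'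
      linear_combination m * (x1 - x2) * hl + (y1 - y2) * hm + e1 - e2
    refine ⟨(x1 - x2) ^ 2, ?_, ?_, ?_⟩
    · simp
    · simp only [WeierstrassCurve.Affine.Point.xRep_some, WeierstrassCurve.Affine.Point.xRep_zero, WeierstrassCurve.Affine.addX, h1, h2, Matrix.cons_val_zero, Matrix.cons_val_one]
      linear_combination (-(l * (x1 - x2) + y1 - y2)) * hl - (m * (x1 - x2) + y1 + y2) * hm
        - 2 * e1 - 2 * e2
    · simp only [WeierstrassCurve.Affine.Point.xRep_some, WeierstrassCurve.Affine.Point.xRep_zero, WeierstrassCurve.Affine.addX, h1, h2, Matrix.cons_val_zero, Matrix.cons_val_one]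
      linear_combination (-(l * m * (x1 - x2) + (x1 ^ 2 + x1 * x2 + x2 ^ 2 + W.a₄))) * hlm +
        (x1 + x2) * ((l * (x1 - x2) + y1 - y2) * hl + (m * (x1 - x2) + y1 + y2) * hm
        + 2 * e1 + 2 * e2)

theorem aux_bez3 {F : Type} [Field F] (a b c : F[X])
    (h : ∀ π : F[X], Prime π → π ∣ a → π ∣ b → π ∣ c → False) :
    ∃ x y z : F[X], x * a + y * b + z * c = 1 := by
  classical
  have hg : IsCoprime a (EuclideanDomain.gcd b c) := by
    by_contra hc
    rw [← EuclideanDomain.gcd_isUnit_iff] at hc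
    have hd1 : EuclideanDomain.gcd a (EuclideanDomain.gcd b c) ∣ a := EuclideanDomain.gcd_dvd_left _ _
    have hd2 := EuclideanDomain.gcd_dvd_right a (EuclideanDomain.gcd b c)
    obtain ⟨π, hπ, hd⟩ : ∃ π : F[X], Prime π ∧ π ∣ EuclideanDomain.gcd a (EuclideanDomain.gcd b c) := by
      by_cases h0 : EuclideanDomain.gcd a (EuclideanDomain.gcd b c) = 0
      · exact ⟨X, prime_X, by rw [h0]; exact dvd_zero _⟩
      · obtain ⟨π, h1, h2⟩ := WfDvdMonoid.exists_irreducible_factor hc h0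
        exact ⟨π, h1.prime, h2⟩
    have h3 := hd.trans hd2
    exact h π hπ (hd.trans hd1) (h3.trans (EuclideanDomain.gcd_dvd_left _ _))
      (h3.trans (EuclideanDomain.gcd_dvd_right _ _))
  obtain ⟨x, y, hxy⟩ := hg
  refine ⟨x, y * EuclideanDomain.gcdA b c, y * EuclideanDomain.gcdB b c, ?_⟩
  rw [EuclideanDomain.gcd_eq_gcd_ab b c] at hxy
  linear_combination hxy

theorem aux_prop {F : Type} [Field F] (t0 t1 t2 s0 s1 s2 : F[X])
    (ht : ∃ x y z : F[X], x * t0 + y * t1 + z * t2 = 1)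
    (hs : ∃ x y z : F[X], x * s0 + y * s1 + z * s2 = 1)
    (h01 : t0 * s1 = t1 * s0) (h02 : t0 * s2 = t2 * s0) (h12 : t1 * s2 = t2 * s1) :
    ∃ c : F[X], IsUnit c ∧ s0 = c * t0 ∧ s1 = c * t1 ∧ s2 = c * t2 := by
  obtain ⟨x, y, z, ht⟩ := ht
  obtain ⟨x', y', z', hs⟩ := hs
  have e0 : s0 = (x * s0 + y * s1 + z * s2) * t0 := by
    linear_combination (-s0) * ht - y * h01 - z * h02
  have e1 : s1 = (x * s0 + y * s1 + z * s2) * t1 := by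
    linear_combination (-s1) * ht + x * h01 - z * h12
  have e2 : s2 = (x * s0 + y * s1 + z * s2) * t2 := by
    linear_combination (-s2) * ht + x * h02 + y * h12
  refine ⟨x * s0 + y * s1 + z * s2, ?_, e0, e1, e2⟩
  refine IsUnit.of_mul_eq_one (x' * t0 + y' * t1 + z' * t2) ?_
  linear_combination hs - x' * e0 - y' * e1 - z' * e2

theorem aux_polB {F : Type} [Field F] (h2 : (2 : F) ≠ 0) (A B : F) (hd : 4 * A ^ 3 + 27 * B ^ 2 ≠ 0)
    (u v u3 v3 u4 v4 : F[X]) (huv : IsCoprime u v) (hlt : v.degree < u.degree)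
    (h3 : IsCoprime u3 v3) (h4 : IsCoprime u4 v4) (t0 t1 t2 : F[X])
    (ht0 : t0 = (u - X * v) ^ 2)
    (ht1 : t1 = 2 * (u + X * v) * (C A * v + u * X) + 4 * C B * v ^ 2)
    (ht2 : t2 = (u * X - C A * v) ^ 2 - 4 * C B * v * (u + X * v))
    (h01 : t0 * (u3 * v4 + v3 * u4) = t1 * (v3 * v4))
    (h02 : t0 * (u3 * u4) = t2 * (v3 * v4))
    (h12 : t1 * (u3 * u4) = t2 * (u3 * v4 + v3 * u4)) :
    v3.degree < u3.degree ∧ v4.degree < u4.degree ∧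
      u3.natDegree + u4.natDegree = 2 * u.natDegree + 2 ∧
      (∃ c : F[X], IsUnit c ∧ v3 * v4 = c * (u - X * v) ^ 2) := by
  have hs : ∃ x y z : F[X], x * (v3 * v4) + y * (u3 * v4 + v3 * u4) + z * (u3 * u4) = 1 := by
    apply aux_bez3
    intro π hπ d0 d1 d2
    have n3 : ¬ (π ∣ u3 ∧ π ∣ v3) := fun ⟨a, b⟩ => hπ.not_isUnit (h3.isUnit_of_dvd' a b)
    have n4 : ¬ (π ∣ u4 ∧ π ∣ v4) := fun ⟨a, b⟩ => hπ.not_isUnit (h4.isUnit_of_dvd' a b)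
    rcases hπ.dvd_or_dvd d0 with h | h
    · have h' := hπ.dvd_or_dvd ((dvd_add_left (h.mul_right u4)).1 d1)
      have := hπ.dvd_or_dvd d2
      tauto
    · have h' := hπ.dvd_or_dvd ((dvd_add_right (h.mul_left u3)).1 d1)
      have := hπ.dvd_or_dvd d2
      tauto
  have ht : ∃ x y z : F[X], x * t0 + y * t1 + z * t2 = 1 := by
    apply aux_bez3
    intro π hπ d0 d1 d2
    have hw : π ∣ u - X * v := by rw [ht0] at d0; exact hπ.dvd_of_dvd_pow d0
    have hnv : ¬ π ∣ v := by
      intro hv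
      exact hπ.not_isUnit (huv.isUnit_of_dvd' ((dvd_sub_left (hv.mul_left X)).1 hw) hv)
    have h4u : IsUnit (C (4 : F)) := by
      rw [isUnit_C]; exact IsUnit.mk0 _ (by intro h; apply h2; have : (2:F)*2 = 0 := by linear_combination h
                                            simpa using this)
    have hf : π ∣ X ^ 3 + C A * X + C B := by
      have : π ∣ C 4 * v ^ 2 * (X ^ 3 + C A * X + C B) := by
        have e : C 4 * v ^ 2 * (X ^ 3 + C A * X + C B) = t1 - (u - X * v) * (2 * u * X + 2 * C A * v + 4 * X ^ 2 * v) := by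
          rw [ht1, show (C (4:F) : F[X]) = 4 from rfl]; ring
        rw [e]; exact dvd_sub d1 (hw.mul_right _)
      rcases hπ.dvd_or_dvd this with h | h
      · rcases hπ.dvd_or_dvd h with h | h
        · exact absurd (isUnit_of_dvd_unit h h4u) hπ.not_isUnit
        · exact absurd (hπ.dvd_of_dvd_pow h) hnv
      · exact h
    have hf' : π ∣ 3 * X ^ 2 + C A := by
      have : π ∣ v ^ 2 * (3 * X ^ 2 + C A) ^ 2 := by
        have e : v ^ 2 * (3 * X ^ 2 + C A) ^ 2 = t2 + 8 * X * v ^ 2 * (X ^ 3 + C A * X + C B)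
            - (u - X * v) * (u * X ^ 2 + X ^ 3 * v - 2 * C A * v * X - 4 * C B * v) := by
          rw [ht2]; ring
        rw [e]
        exact dvd_sub (dvd_add d2 (hf.mul_left _)) (hw.mul_right _)
      rcases hπ.dvd_or_dvd this with h | h
      · exact absurd (hπ.dvd_of_dvd_pow h) hnv
      · exact hπ.dvd_of_dvd_pow h
    have : π ∣ C (4 * A ^ 3 + 27 * B ^ 2) := by
      have e : C (4 * A ^ 3 + 27 * B ^ 2) = (6 * C A * X ^ 2 - 9 * C B * X + 4 * C A ^ 2) * (3 * X ^ 2 + C A)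
          - (18 * C A * X - 27 * C B) * (X ^ 3 + C A * X + C B) := by
        simp only [map_add, map_mul, map_pow]
        rw [show (C (4:F) : F[X]) = 4 from rfl, show (C (27:F) : F[X]) = 27 from rfl]
        ring
      rw [e]
      exact dvd_sub (hf'.mul_left _) (hf.mul_left _)
    exact hπ.not_isUnit (isUnit_of_dvd_unit this (isUnit_C.2 (IsUnit.mk0 _ hd)))
  obtain ⟨c, hc, e0, e1, e2⟩ := aux_prop _ _ _ _ _ _ ht hs h01 h02 h12
  have hu0 : u ≠ 0 := by rintro rfl; simp at hlt
  have hcd : ∀ t : F[X], (c * t).natDegree = t.natDegree := by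
    intro t
    obtain ⟨k, hk, rfl⟩ := Polynomial.isUnit_iff.1 hc
    exact natDegree_C_mul hk.ne_zero
  set n := u.natDegree with hn
  have hXv : (X * v).natDegree ≤ n := by
    by_cases h : v = 0
    · simp [h]
    · rw [natDegree_X_mul h]; exact natDegree_lt_natDegree h hlt
  have hvn : v.natDegree ≤ n := natDegree_le_natDegree hlt.le
  have hA : ∀ (k : F) (t : F[X]) (m : ℕ), t.natDegree ≤ m → (C k * t).natDegree ≤ m := fun k t m h =>
    (natDegree_C_mul_le k t).trans h
  have hb1 : t1.natDegree ≤ 2 * n + 1 := by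
    have e : t1 = C 2 * ((u + X * v) * (C A * v + u * X)) + C (4 * B) * (v * v) := by
      rw [ht1, map_mul, show (C (4:F) : F[X]) = 4 from rfl, show (C (2:F) : F[X]) = 2 from rfl]; ring
    rw [e]
    refine natDegree_add_le_of_degree_le (hA _ _ _ ?_) (hA _ _ _ ?_)
    · refine (natDegree_mul_le_of_le (m := n) (n := n + 1) ?_ ?_).trans (by omega)
      · exact natDegree_add_le_of_degree_le le_rfl hXv
      · refine natDegree_add_le_of_degree_le (hA _ _ _ (by omega)) ?_
        rw [natDegree_mul_X hu0]
    · exact (natDegree_mul_le_of_le hvn hvn).trans (by omega)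
  have hb0 : t0.natDegree ≤ 2 * n := by
    rw [ht0]
    refine natDegree_pow_le.trans ?_
    have : (u - X * v).natDegree ≤ n := (natDegree_sub_le_of_le le_rfl hXv).trans (by simp [hn])
    omega
  have hb2 : t2.natDegree = 2 * n + 2 := by
    have e : t2 = (C (-2 * A) * (u * (X * v)) + C (A ^ 2) * (v * v) + C (-4 * B) * (v * (u + X * v))) + (u * X) ^ 2 := by
      rw [ht2]
      simp only [map_mul, map_neg, map_pow]
      rw [show (C (4:F) : F[X]) = 4 from rfl, show (C (2:F) : F[X]) = 2 from rfl]; ring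
    have hR : (C (-2 * A) * (u * (X * v)) + C (A ^ 2) * (v * v) + C (-4 * B) * (v * (u + X * v))).natDegree ≤ 2 * n := by
      refine natDegree_add_le_of_degree_le (natDegree_add_le_of_degree_le (hA _ _ _ ?_) (hA _ _ _ ?_)) (hA _ _ _ ?_)
      · exact (natDegree_mul_le_of_le le_rfl hXv).trans (by omega)
      · exact (natDegree_mul_le_of_le hvn hvn).trans (by omega)
      · exact (natDegree_mul_le_of_le hvn (natDegree_add_le_of_degree_le le_rfl hXv)).trans (by omega)
    have h1 : ((u * X) ^ 2).natDegree = 2 * n + 2 := by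
      rw [natDegree_pow, natDegree_mul_X hu0]; omega
    rw [e, natDegree_add_eq_right_of_natDegree_lt (by omega), h1]
  have g0 : (v3 * v4).natDegree ≤ 2 * n := by rw [e0, hcd]; exact hb0
  have g1 : (u3 * v4 + v3 * u4).natDegree ≤ 2 * n + 1 := by rw [e1, hcd]; exact hb1
  have g2 : (u3 * u4).natDegree = 2 * n + 2 := by rw [e2, hcd]; exact hb2
  have hu3 : u3 ≠ 0 := by rintro rfl; simp at g2
  have hu4 : u4 ≠ 0 := by rintro rfl; simp at g2
  rw [natDegree_mul hu3 hu4] at g2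
  refine ⟨?_, ?_, g2, c, hc, by rw [e0, ht0]⟩
  · by_contra hcon
    have hcon' : u3.degree ≤ v3.degree := not_lt.1 hcon
    have hv3 : v3 ≠ 0 := by rintro rfl; simp at hcon'; exact hu3 hcon'
    have hdeg := natDegree_le_natDegree hcon'
    by_cases hv4 : v4 = 0
    · rw [hv4, mul_zero, zero_add, natDegree_mul hv3 hu4] at g1; omega
    · rw [natDegree_mul hv3 hv4] at g0
      rw [natDegree_add_eq_right_of_natDegree_lt (by rw [natDegree_mul hu3 hv4, natDegree_mul hv3 hu4]; omega),
        natDegree_mul hv3 hu4] at g1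
      omega
  · by_contra hcon
    have hcon' : u4.degree ≤ v4.degree := not_lt.1 hcon
    have hv4 : v4 ≠ 0 := by rintro rfl; simp at hcon'; exact hu4 hcon'
    have hdeg := natDegree_le_natDegree hcon'
    by_cases hv3 : v3 = 0
    · rw [hv3, zero_mul, add_zero, natDegree_mul hu3 hv4] at g1; omega
    · rw [natDegree_mul hv3 hv4] at g0
      rw [natDegree_add_eq_left_of_natDegree_lt (by rw [natDegree_mul hu3 hv4, natDegree_mul hv3 hu4]; omega),
        natDegree_mul hu3 hv4] at g1
      omega

open WeierstrassCurve.Affine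
set_option linter.unusedSectionVars false

/-- Function-field setup for the curve `y² = x³ + Ax + B`. -/
structure EllSetup (F L : Type) [Field F] [Field L] [Algebra F L] [Algebra (RatFunc F) L]
    [IsScalarTower F (RatFunc F) L] (A B : F) where
  w : L
  h2 : (2 : F) ≠ 0
  hd : 4 * A ^ 3 + 27 * B ^ 2 ≠ 0
  hw : w ^ 2 = algebraMap (RatFunc F) L (algebraMap F[X] (RatFunc F) (X ^ 3 + C A * X + C B))
  hspan : ∀ z : L, ∃ a b : RatFunc F, z = algebraMap _ L a + algebraMap _ L b * w
  hnm : ∀ a : RatFunc F, algebraMap _ L a ≠ w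
  hrank : Module.finrank (RatFunc F) L = 2
  hlift : ∀ (i : RatFunc F →ₐ[F] L) (w' : L),
    w' ^ 2 = i (algebraMap F[X] (RatFunc F) (X ^ 3 + C A * X + C B)) →
    ∃ ρ : L →ₐ[F] L, (∀ k, ρ (algebraMap _ L k) = i k) ∧ ρ w = w'
  hns : ((shortWeierstrass F A B)⁄L).Nonsingular (algebraMap (RatFunc F) L RatFunc.X) w

section
variable {F L : Type} [Field F] [Field L] [Algebra F L] [Algebra (RatFunc F) L]
    [IsScalarTower F (RatFunc F) L] {A B : F}

/-- The embedding of polynomials into the function field. -/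
noncomputable def iotaL (F L : Type) [Field F] [Field L] [Algebra (RatFunc F) L] : F[X] →+* L :=
  (algebraMap (RatFunc F) L).comp (algebraMap F[X] (RatFunc F))

theorem iotaL_inj : Function.Injective (iotaL F L) :=
  (algebraMap (RatFunc F) L).injective.comp (RatFunc.algebraMap_injective F)

theorem iotaL_X : iotaL F L X = algebraMap (RatFunc F) L RatFunc.X := by
  simp [iotaL]

theorem iotaL_C (a : F) : iotaL F L (C a) = algebraMap F L a := by
  simp [iotaL, IsScalarTower.algebraMap_apply F (RatFunc F) L]

/-- `(u : v)` are coprime polynomial homogeneous coordinates of the `x`-coordinate of `P`. -/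
def HasRep (P : ((shortWeierstrass F A B)⁄L).Point) (u v : F[X]) : Prop :=
  IsCoprime u v ∧ ∃ l : L, iotaL F L u = l * P.xRep 0 ∧ iotaL F L v = l * P.xRep 1

/-- `P` has a representation of degree `d` with pole at infinity. -/
def GoodDeg (P : ((shortWeierstrass F A B)⁄L).Point) (d : ℕ) : Prop :=
  ∃ u v : F[X], HasRep P u v ∧ v.degree < u.degree ∧ u.natDegree = d

theorem HasRep.assoc {P : ((shortWeierstrass F A B)⁄L).Point} {u v u' v' : F[X]}
    (h : HasRep P u v) (h' : HasRep P u' v') : Associated u u' ∧ Associated v v' := by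
  obtain ⟨hc, l, h0, h1⟩ := h
  obtain ⟨hc', l', h0', h1'⟩ := h'
  have e : u * v' = u' * v := by
    apply iotaL_inj (L := L)
    rw [map_mul, map_mul, h0, h1, h0', h1']; ring
  refine ⟨associated_of_dvd_dvd ?_ ?_, associated_of_dvd_dvd ?_ ?_⟩
  · exact hc.dvd_of_dvd_mul_right (Dvd.intro _ e)
  · exact hc'.dvd_of_dvd_mul_right (Dvd.intro _ e.symm)
  · exact hc.symm.dvd_of_dvd_mul_left (Dvd.intro_left _ e.symm)
  · exact hc'.symm.dvd_of_dvd_mul_left (Dvd.intro_left _ e)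

theorem HasRep.natDegree_eq {P : ((shortWeierstrass F A B)⁄L).Point} {u v u' v' : F[X]}
    (h : HasRep P u v) (h' : HasRep P u' v') : u.natDegree = u'.natDegree := 
  natDegree_eq_of_degree_eq (degree_eq_degree_of_associated (h.assoc h').1)

theorem GoodDeg.unique {P : ((shortWeierstrass F A B)⁄L).Point} {d d' : ℕ}
    (h : GoodDeg P d) (h' : GoodDeg P d') : d = d' := by
  obtain ⟨u, v, h1, -, rfl⟩ := h
  obtain ⟨u', v', h1', -, rfl⟩ := h'
  exact h1.natDegree_eq h1'

namespace EllSetup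

variable (S : EllSetup F L A B)

/-- The generic point. -/
noncomputable def g : ((shortWeierstrass F A B)⁄L).Point := Point.some _ _ S.hns

theorem exists_rep_of_mem (P : ((shortWeierstrass F A B)⁄L).Point) 
    (h : ∀ x y hxy, P = Point.some x y hxy → ∃ a : RatFunc F, x = algebraMap _ L a) :
    ∃ u v, HasRep P u v := by
  rcases P with _ | ⟨x, y, hP⟩
  · refine ⟨1, 0, isCoprime_one_left, 1, ?_, ?_⟩ <;> rw [← Point.zero_def] <;> simp
  · obtain ⟨a, rfl⟩ := h x y hP rfl
    refine ⟨a.num, a.denom, a.isCoprime_num_denom, iotaL F L a.denom, ?_, by simp⟩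
    have := a.num_div_denom
    rw [div_eq_iff (by simpa using a.denom_ne_zero)] at this
    simp [iotaL, this, mul_comm]

theorem exists_conj : ∃ c : L →ₐ[F] L, (∀ k, c (algebraMap (RatFunc F) L k) = algebraMap _ L k) ∧ c S.w = -S.w := by
  obtain ⟨c, h1, h2⟩ := S.hlift (IsScalarTower.toAlgHom F (RatFunc F) L) (-S.w) (by
    rw [neg_sq, S.hw]; rfl)
  exact ⟨c, h1, h2⟩

theorem fixed_of_conj (c : L →ₐ[F] L) (h1 : ∀ k, c (algebraMap (RatFunc F) L k) = algebraMap _ L k)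
    (h2 : c S.w = -S.w) (x : L) (hx : c x = x) : ∃ a : RatFunc F, x = algebraMap _ L a := by
  obtain ⟨a, b, rfl⟩ := S.hspan x
  refine ⟨a, ?_⟩
  rw [map_add, map_mul, h1, h1, h2] at hx
  have hw0 : S.w ≠ 0 := by
    intro h; exact S.hnm 0 (by rw [h, map_zero])
  have h2' : (2 : L) ≠ 0 := by
    have := (map_ne_zero (algebraMap F L)).2 S.h2
    rwa [map_ofNat] at this
  have : 2 * S.w * algebraMap _ L b = 0 := by linear_combination -hx
  have : algebraMap (RatFunc F) L b = 0 := by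
    rcases mul_eq_zero.1 this with h | h
    · rcases mul_eq_zero.1 h with h | h
      · exact absurd h h2'
      · exact absurd h hw0
    · exact h
  rw [this]; ring

variable [DecidableEq L]

theorem map_conj_g (c : L →ₐ[F] L) (h1 : ∀ k, c (algebraMap (RatFunc F) L k) = algebraMap _ L k)
    (h2 : c S.w = -S.w) : Point.map c S.g = -S.g := by
  rw [g, Point.map_some, Point.neg_some]
  simp [h1, h2, negY, shortWeierstrass]

theorem exists_rep (c : L →ₐ[F] L) (h1 : ∀ k, c (algebraMap (RatFunc F) L k) = algebraMap _ L k)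
    (h2 : c S.w = -S.w) (P : ((shortWeierstrass F A B)⁄L).Point) (hP : Point.map c P = -P) :
    ∃ u v, HasRep P u v := by
  apply exists_rep_of_mem
  rintro x y hxy rfl
  apply S.fixed_of_conj c h1 h2
  rw [Point.map_some, Point.neg_some] at hP
  simp only [Point.some.injEq] at hP
  exact hP.1

theorem step (P : ((shortWeierstrass F A B)⁄L).Point) {u v u3 v3 u4 v4 : F[X]}
    (h : HasRep P u v) (hlt : v.degree < u.degree) (h3 : HasRep (P + S.g) u3 v3)
    (h4 : HasRep (P - S.g) u4 v4) :
    v3.degree < u3.degree ∧ v4.degree < u4.degree ∧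
      u3.natDegree + u4.natDegree = 2 * u.natDegree + 2 ∧
      (∃ c : F[X], IsUnit c ∧ v3 * v4 = c * (u - X * v) ^ 2) := by
  obtain ⟨c, e0, e1, e2⟩ := aux_addsub ((shortWeierstrass F A B)⁄L) (by simp [shortWeierstrass])
    (by simp [shortWeierstrass]) (by simp [shortWeierstrass]) P S.g
  obtain ⟨hc, l, lu, lv⟩ := h
  obtain ⟨hc3, m, mu, mv⟩ := h3
  obtain ⟨hc4, n, nu, nv⟩ := h4
  have g0 : S.g.xRep 0 = iotaL F L X := by rw [iotaL_X]; rfl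
  have g1 : S.g.xRep 1 = 1 := rfl
  have ha4 : ((shortWeierstrass F A B)⁄L).a₄ = iotaL F L (C A) := by simp [iotaL_C, shortWeierstrass]
  have ha6 : ((shortWeierstrass F A B)⁄L).a₆ = iotaL F L (C B) := by simp [iotaL_C, shortWeierstrass]
  simp only [g0, g1, ha4, ha6] at e0 e1 e2
  set r0 := (P + S.g).xRep 0
  set r1 := (P + S.g).xRep 1
  set s0 := (P - S.g).xRep 0
  set s1 := (P - S.g).xRep 1
  set p0 := P.xRep 0
  set p1 := P.xRep 1
  have E0 : iotaL F L ((u - X * v) ^ 2) = l ^ 2 * c * (r1 * s1) := by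
    simp only [map_mul, map_sub, map_pow, lu, lv]
    linear_combination l ^ 2 * e0
  have E1 : iotaL F L (2 * (u + X * v) * (C A * v + u * X) + 4 * C B * v ^ 2) = l ^ 2 * c * (r0 * s1 + r1 * s0) := by
    simp only [map_mul, map_add, map_pow, lu, lv, map_ofNat]
    linear_combination l ^ 2 * e1
  have E2 : iotaL F L ((u * X - C A * v) ^ 2 - 4 * C B * v * (u + X * v)) = l ^ 2 * c * (r0 * s0) := by
    simp only [map_mul, map_add, map_sub, map_pow, lu, lv, map_ofNat]
    linear_combination l ^ 2 * e2
  refine aux_polB S.h2 A B S.hd u v u3 v3 u4 v4 hc hlt hc3 hc4 _ _ _ rfl rfl rfl ?_ ?_ ?_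
  · apply iotaL_inj (L := L)
    rw [map_mul, E0, map_mul, E1]
    simp only [map_mul, map_add, mu, mv, nu, nv]; ring
  · apply iotaL_inj (L := L)
    rw [map_mul, E0, map_mul (iotaL F L) (_ - _), E2]
    simp only [map_mul, map_add, mu, mv, nu, nv]; ring
  · apply iotaL_inj (L := L)
    rw [map_mul, E1, map_mul (iotaL F L) (_ - _), E2]
    simp only [map_mul, map_add, mu, mv, nu, nv]; ring

end EllSetup
end


namespace EllSetup
section
variable {F L : Type} [Field F] [Field L] [Algebra F L] [Algebra (RatFunc F) L]
    [IsScalarTower F (RatFunc F) L] {A B : F} (S : EllSetup F L A B) [Fintype F] [DecidableEq L]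

/-- `φ(g) - n g`. -/
noncomputable def Pn (n : ℤ) : ((shortWeierstrass F A B)⁄L).Point :=
  Point.map (FiniteField.frobeniusAlgHom F L) S.g - n • S.g

theorem map_frob (c : L →ₐ[F] L) (P : ((shortWeierstrass F A B)⁄L).Point) :
    Point.map c (Point.map (FiniteField.frobeniusAlgHom F L) P) =
      Point.map (FiniteField.frobeniusAlgHom F L) (Point.map c P) := by
  rw [Point.map_map, Point.map_map]
  congr 2
  ext x
  simp

theorem conj_Pn (c : L →ₐ[F] L) (h1 : ∀ k, c (algebraMap (RatFunc F) L k) = algebraMap _ L k)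
    (h2 : c S.w = -S.w) (n : ℤ) : Point.map c (S.Pn n) = - S.Pn n := by
  rw [Pn, map_sub, map_zsmul, map_frob, S.map_conj_g c h1 h2]
  simp only [map_neg, smul_neg]
  abel

theorem exists_rep_Pn (n : ℤ) : ∃ u v, HasRep (S.Pn n) u v := by
  obtain ⟨c, h1, h2⟩ := S.exists_conj
  exact S.exists_rep c h1 h2 _ (S.conj_Pn c h1 h2 n)

theorem Pn_add (n : ℤ) : S.Pn n + S.g = S.Pn (n - 1) := by
  simp only [Pn, sub_smul, one_smul]; abel

theorem Pn_sub (n : ℤ) : S.Pn n - S.g = S.Pn (n + 1) := by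
  simp only [Pn, add_smul, one_smul]; abel

theorem rep_zero : HasRep (S.Pn 0) (X ^ Fintype.card F) 1 := by
  refine ⟨isCoprime_one_right, 1, ?_, ?_⟩
  · simp only [Pn, zero_smul, sub_zero, g, Point.map_some, map_pow, iotaL_X]
    simp
  · simp only [Pn, zero_smul, sub_zero, g, Point.map_some]
    simp

theorem good_zero : GoodDeg (S.Pn 0) (Fintype.card F) := by
  refine ⟨_, _, S.rep_zero, ?_, by simp⟩
  rw [degree_X_pow, degree_one]
  exact_mod_cast Fintype.card_pos

theorem good_step (n : ℤ) (d : ℕ) (h : GoodDeg (S.Pn n) d) :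
    ∃ d3 d4, GoodDeg (S.Pn (n - 1)) d3 ∧ GoodDeg (S.Pn (n + 1)) d4 ∧ d3 + d4 = 2 * d + 2 := by
  obtain ⟨u, v, hr, hlt, rfl⟩ := h
  obtain ⟨u3, v3, h3⟩ := S.exists_rep_Pn (n - 1)
  obtain ⟨u4, v4, h4⟩ := S.exists_rep_Pn (n + 1)
  have := S.step (S.Pn n) hr hlt (by rw [Pn_add]; exact h3) (by rw [Pn_sub]; exact h4)
  exact ⟨_, _, ⟨u3, v3, h3, this.1, rfl⟩, ⟨u4, v4, h4, this.2.1, rfl⟩, this.2.2.1⟩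

theorem exists_seq : ∃ d : ℤ → ℕ, (∀ n, GoodDeg (S.Pn n) (d n)) ∧ d 0 = Fintype.card F ∧
    ∀ n, d (n - 1) + d (n + 1) = 2 * d n + 2 := by
  have hex : ∀ n : ℤ, ∃ d, GoodDeg (S.Pn n) d := by
    intro n
    induction n with
    | zero => exact ⟨_, S.good_zero⟩
    | succ n ih =>
      obtain ⟨d, hd⟩ := ih
      obtain ⟨d3, d4, h3, h4, -⟩ := S.good_step _ d hd
      exact ⟨d4, h4⟩
    | pred n ih =>
      obtain ⟨d, hd⟩ := ih
      obtain ⟨d3, d4, h3, h4, -⟩ := S.good_step _ d hd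
      exact ⟨d3, h3⟩
  choose d hd using hex
  refine ⟨d, hd, (hd 0).unique S.good_zero, fun n => ?_⟩
  obtain ⟨d3, d4, h3, h4, h⟩ := S.good_step n _ (hd n)
  rw [(hd (n - 1)).unique h3, (hd (n + 1)).unique h4, h]

/-- exponents -/
noncomputable def ee (A B : F) (x : F) : ℕ := by
  classical
  exact if x ^ 3 + A * x + B = 0 then 1 else if IsSquare (x ^ 3 + A * x + B) then 2 else 0

theorem ee_le (x : F) : ee A B x ≤ 2 := by
  unfold ee; split_ifs <;> omega

theorem prod_X_sub : (∏ x : F, (X - C x)) = (X : F[X]) ^ Fintype.card F - X := by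
  have h1 : ((X : F[X]) ^ Fintype.card F - X).Monic := by
    apply monic_X_pow_sub
    rw [degree_X]
    exact_mod_cast Fintype.one_lt_card
  have h2 := prod_multiset_X_sub_C_of_monic_of_roots_card_eq h1 (by
    rw [FiniteField.roots_X_pow_card_sub_X, FiniteField.X_pow_card_sub_X_natDegree_eq F Fintype.one_lt_card]
    rfl)
  rw [FiniteField.roots_X_pow_card_sub_X] at h2
  exact h2

theorem prod_ee_mul (e e' : F → ℕ) (h : ∀ x, e x + e' x = 2) :
    (∏ x : F, (X - C x) ^ e x) * (∏ x : F, (X - C x) ^ e' x) = ((X : F[X]) ^ Fintype.card F - X) ^ 2 := by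
  rw [← Finset.prod_mul_distrib, ← prod_X_sub, ← Finset.prod_pow]
  refine Finset.prod_congr rfl fun x _ => ?_
  rw [← pow_add, h]

theorem dvd_prod (e e' : F → ℕ) (h : ∀ x, e x + e' x = 2) (eps : F)
    (s : F[X]) (hs : iotaL F L s * S.w = S.w ^ Fintype.card F)
    (hdv : ∀ x, (X - C x) ^ e' x ∣ (X ^ 3 + C A * X + C B) * (s + C eps) ^ 2)
    (y2 : L) (hy2 : y2 = - (algebraMap F L eps * S.w))
    (hQ : ((shortWeierstrass F A B)⁄L).Nonsingular (algebraMap (RatFunc F) L RatFunc.X) y2)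
    (u v : F[X]) (huv : HasRep (S.Pn 0 + Point.some _ _ hQ) u v) :
    v ∣ ∏ x : F, (X - C x) ^ e x := by
  have hD := prod_ee_mul e e' h
  set D := ∏ x : F, (X - C x) ^ e x
  set D' := ∏ x : F, (X - C x) ^ e' x
  have hh0 : ((X : F[X]) ^ Fintype.card F - X) ≠ 0 :=
    FiniteField.X_pow_card_sub_X_ne_zero F Fintype.one_lt_card
  have hD'0 : D' ≠ 0 := by
    intro h0; rw [h0, mul_zero] at hD
    exact pow_ne_zero 2 hh0 hD.symm
  have hdvd : D' ∣ (X ^ 3 + C A * X + C B) * (s + C eps) ^ 2 := by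
    apply Finset.prod_dvd_of_coprime
    · intro x _ y _ hxy
      exact (isCoprime_X_sub_C_of_isUnit_sub (sub_ne_zero.2 hxy).isUnit).pow
    · intro x _; exact hdv x
  obtain ⟨V, hV⟩ := hdvd
  obtain ⟨hc, l, lu, lv⟩ := huv
  set t := algebraMap (RatFunc F) L RatFunc.X with ht
  have hιh : iotaL F L ((X : F[X]) ^ Fintype.card F - X) = t ^ Fintype.card F - t := by
    rw [map_sub, map_pow, iotaL_X]
  have hne : t ^ Fintype.card F - t ≠ 0 := by
    rw [← hιh]; exact (map_ne_zero_iff _ iotaL_inj).2 hh0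
  have hP0 : ∃ hns, S.Pn 0 = Point.some (W' := (shortWeierstrass F A B)⁄L) (t ^ Fintype.card F) (S.w ^ Fintype.card F) hns := by
    refine ⟨?_, ?_⟩
    rotate_left
    · simp only [Pn, zero_smul, sub_zero, g, Point.map_some]
      simp [ht]
    · have := (((shortWeierstrass F A B)).baseChange_nonsingular (FiniteField.frobeniusAlgHom F L).injective t S.w).2 S.hns
      simpa using this
  obtain ⟨hns, hP0⟩ := hP0
  have hx : t ^ Fintype.card F ≠ t := fun h => hne (by rw [h, sub_self])
  rw [hP0, Point.add_of_X_ne hx] at lu lv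
  have hl := WeierstrassCurve.Affine.slope_of_X_ne (W := ((shortWeierstrass F A B)⁄L)) (y₁ := S.w ^ Fintype.card F) (y₂ := y2) hx
  simp only [Point.xRep_some, addX, Matrix.cons_val_zero, Matrix.cons_val_one] at lu lv
  set m := slope ((shortWeierstrass F A B)⁄L) (t ^ Fintype.card F) t (S.w ^ Fintype.card F) y2
  have a1 : ((shortWeierstrass F A B)⁄L).a₁ = 0 := by simp [shortWeierstrass]
  have a2 : ((shortWeierstrass F A B)⁄L).a₂ = 0 := by simp [shortWeierstrass]
  rw [a1, a2] at lu
  rw [eq_div_iff hne, ← hs, hy2, ← iotaL_C] at hl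
  have key : u * ((X : F[X]) ^ Fintype.card F - X) ^ 2 =
      v * (D' * V - (X ^ Fintype.card F + X) * ((X : F[X]) ^ Fintype.card F - X) ^ 2) := by
    apply iotaL_inj (L := L)
    rw [← hV]
    have hw := S.hw
    change S.w ^ 2 = iotaL F L _ at hw
    rw [map_mul, map_mul, map_sub, map_mul, map_mul, map_pow, map_pow, hιh, ← hw, lu, lv]
    simp only [map_add, map_pow, iotaL_X]
    rw [← ht]
    linear_combination l * (m * (t ^ Fintype.card F - t) + S.w * (iotaL F L s + iotaL F L (C eps))) * hl
  rw [← hD] at key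
  have key2 : D * u = v * (V - (X ^ Fintype.card F + X) * D) := by
    apply mul_left_cancel₀ hD'0
    linear_combination key
  exact hc.symm.dvd_of_dvd_mul_right (Dvd.intro _ key2.symm)
end
end EllSetup


namespace EllSetup
section
variable {F L : Type} [Field F] [Field L] [Algebra F L] [Algebra (RatFunc F) L]
    [IsScalarTower F (RatFunc F) L] {A B : F} (S : EllSetup F L A B) [Fintype F] [DecidableEq L]

theorem ringChar_ne {F : Type} [Field F] (h2 : (2 : F) ≠ 0) : ringChar F ≠ 2 := by
  intro h
  have := ringChar.Nat.cast_ringChar (R := F)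
  rw [h] at this
  exact h2 (by exact_mod_cast this)

theorem d_one (d : ℕ) (hd : GoodDeg (S.Pn 1) d) : d = 1 + ∑ x : F, ee A B x := by
  classical
  have hchar := ringChar_ne S.h2
  have hodd := FiniteField.odd_card_of_char_ne_two hchar
  set q := Fintype.card F with hq
  set f : F[X] := X ^ 3 + C A * X + C B with hf
  set s : F[X] := f ^ (q / 2) with hs
  have hsw : iotaL F L s * S.w = S.w ^ q := by
    have hw := S.hw
    change S.w ^ 2 = iotaL F L _ at hw
    rw [hs, map_pow, hf, ← hw, ← pow_mul, ← pow_succ]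
    congr 1; omega
  have hfe : ∀ x, f.eval x = x ^ 3 + A * x + B := by intro x; simp [hf]
  obtain ⟨u3, v3, h3⟩ := S.exists_rep_Pn (0 - 1)
  obtain ⟨u4, v4, h4⟩ := S.exists_rep_Pn (0 + 1)
  have hst := S.step (S.Pn 0) S.rep_zero (by
    rw [degree_X_pow, degree_one]; exact_mod_cast Fintype.card_pos)
    (by rw [Pn_add]; exact h3) (by rw [Pn_sub]; exact h4)
  obtain ⟨l3, l4, hsum, c, hc, hv⟩ := hst
  have hde : d = u4.natDegree := by
    obtain ⟨u, v, h, -, rfl⟩ := hd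
    exact h.natDegree_eq (by simpa using h4)
  have hv34 : v3 * v4 ≠ 0 := by
    rw [hv, mul_one]
    exact mul_ne_zero hc.ne_zero (pow_ne_zero 2 (FiniteField.X_pow_card_sub_X_ne_zero F Fintype.one_lt_card))
  have hv3 : v3 ≠ 0 := left_ne_zero_of_mul hv34
  have hv4 : v4 ≠ 0 := right_ne_zero_of_mul hv34
  have hdv : v3.natDegree + v4.natDegree = 2 * q := by
    rw [← natDegree_mul hv3 hv4, hv, mul_one]
    obtain ⟨k, hk, rfl⟩ := Polynomial.isUnit_iff.1 hc
    rw [natDegree_C_mul hk.ne_zero, natDegree_pow, FiniteField.X_pow_card_sub_X_natDegree_eq F Fintype.one_lt_card]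
  have hu3 := natDegree_lt_natDegree hv3 l3
  have hu4 := natDegree_lt_natDegree hv4 l4
  rw [natDegree_X_pow] at hsum
  have hns : ((shortWeierstrass F A B)⁄L).Nonsingular (algebraMap (RatFunc F) L RatFunc.X) (-S.w) := by
    have := (nonsingular_neg (W' := ((shortWeierstrass F A B)⁄L)) (algebraMap (RatFunc F) L RatFunc.X) S.w).2 S.hns
    simpa [negY, shortWeierstrass] using this
  have hneg : Point.some _ _ hns = - S.g := by
    rw [g, Point.neg_some]
    simp [negY, shortWeierstrass]
  have hroot : ∀ x (p : F[X]), p.eval x = 0 → (X - C x) ∣ p := fun x p h => dvd_iff_isRoot.2 h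
  have hd4 : v4 ∣ ∏ x : F, (X - C x) ^ (ee A B x) := by
    refine S.dvd_prod (ee A B) (fun x => 2 - ee A B x) (fun x => by have := ee_le (A := A) (B := B) x; omega) 1 s hsw ?_ (-S.w) (by simp) hns
      u4 v4 (by rw [hneg, ← sub_eq_add_neg, Pn_sub]; exact h4)
    intro x
    by_cases h0 : x ^ 3 + A * x + B = 0
    · have : ee A B x = 1 := by unfold ee; rw [if_pos h0]
      rw [this, pow_one]
      exact (hroot x f (by rw [hfe, h0])).mul_right _
    · by_cases hsq : IsSquare (x ^ 3 + A * x + B)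
      · have : ee A B x = 2 := by unfold ee; rw [if_neg h0, if_pos hsq]
        simp [this]
      · have : ee A B x = 0 := by unfold ee; rw [if_neg h0, if_neg hsq]
        rw [this]
        refine (pow_dvd_pow_of_dvd (hroot x _ ?_) 2).mul_left _
        rw [FiniteField.isSquare_iff hchar h0] at hsq
        have := (FiniteField.pow_dichotomy hchar h0).resolve_left hsq
        simp only [hs, eval_add, eval_pow, hfe, eval_C, this, hq]
        ring
  have hd3 : v3 ∣ ∏ x : F, (X - C x) ^ (2 - ee A B x) := by
    refine S.dvd_prod (fun x => 2 - ee A B x) (ee A B) (fun x => by have := ee_le (A := A) (B := B) x; omega) (-1) s hsw ?_ S.w (by simp) S.hns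
      u3 v3 (by rw [← g, Pn_add]; exact h3)
    intro x
    by_cases h0 : x ^ 3 + A * x + B = 0
    · have : ee A B x = 1 := by unfold ee; rw [if_pos h0]
      rw [this, pow_one]
      exact (hroot x f (by rw [hfe, h0])).mul_right _
    · by_cases hsq : IsSquare (x ^ 3 + A * x + B)
      · have : ee A B x = 2 := by unfold ee; rw [if_neg h0, if_pos hsq]
        rw [this]
        refine (pow_dvd_pow_of_dvd (hroot x _ ?_) 2).mul_left _
        rw [FiniteField.isSquare_iff hchar h0] at hsq
        simp only [hs, eval_add, eval_pow, hfe, eval_C, hsq, hq]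
        ring
      · have : ee A B x = 0 := by unfold ee; rw [if_neg h0, if_neg hsq]
        simp [this]
  have hdeg : ∀ e : F → ℕ, (∏ x : F, (X - C x) ^ (e x) : F[X]).natDegree = ∑ x, e x := by
    intro e
    rw [natDegree_prod_of_monic _ _ (fun x _ => (monic_X_sub_C x).pow _)]
    simp
  have hnz : ∀ e : F → ℕ, (∏ x : F, (X - C x) ^ (e x) : F[X]) ≠ 0 := by
    intro e
    exact (monic_prod_of_monic _ _ (fun x _ => (monic_X_sub_C x).pow _)).ne_zero
  have b4 := natDegree_le_of_dvd hd4 (hnz _)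
  have b3 := natDegree_le_of_dvd hd3 (hnz _)
  rw [hdeg] at b3 b4
  have hS : ∑ x : F, (2 - ee A B x) + ∑ x : F, ee A B x = 2 * q := by
    rw [← Finset.sum_add_distrib, Finset.sum_congr rfl (g := fun _ => 2)]
    · simp [hq, mul_comm]
    · intro x _; have := ee_le (A := A) (B := B) x; omega
  omega

/-- Existence of degrees: `d n = n² - a n + q` with `a = q + 1 - N`. -/
theorem good_formula (n : ℤ) : ∃ d : ℕ, GoodDeg (S.Pn n) d ∧
    (d : ℤ) = n ^ 2 - (Fintype.card F - ∑ x : F, (ee A B x : ℤ)) * n + Fintype.card F := by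
  obtain ⟨d, hd, h0, hr⟩ := S.exists_seq
  have h1 := S.d_one _ (hd 1)
  refine ⟨d n, hd n, ?_⟩
  have h1' : (d 1 : ℤ) = 1 + ∑ x : F, (ee A B x : ℤ) := by rw [h1]; push_cast; rfl
  have hr' : ∀ n, (d (n - 1) : ℤ) + d (n + 1) = 2 * d n + 2 := fun n => by exact_mod_cast hr n
  have key : ∀ m : ℤ, (d m : ℤ) = m ^ 2 - (Fintype.card F - ∑ x : F, (ee A B x : ℤ)) * m + Fintype.card F ∧
    (d (m + 1) : ℤ) = (m + 1) ^ 2 - (Fintype.card F - ∑ x : F, (ee A B x : ℤ)) * (m + 1) + Fintype.card F := by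
    intro m
    induction m with
    | zero => simp [h0, h1']; ring
    | succ m ih =>
      refine ⟨ih.2, ?_⟩
      have := hr' (m + 1)
      rw [add_sub_cancel_right, ih.1, ih.2] at this
      linear_combination this
    | pred m ih =>
      rw [sub_add_cancel]
      refine ⟨?_, ih.1⟩
      have := hr' (-m)
      rw [ih.1, ih.2] at this
      linear_combination this
  exact (key n).1
end
end EllSetup


namespace EllSetup
section
variable {F L : Type} [Field F] [Field L] [Algebra F L] [Algebra (RatFunc F) L]
    [IsScalarTower F (RatFunc F) L] {A B : F} (S : EllSetup F L A B) [DecidableEq F] [DecidableEq L]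

theorem t_transc : Transcendental F (algebraMap (RatFunc F) L RatFunc.X) := by
  rw [transcendental_iff_injective]
  intro a b hab
  apply iotaL_inj (L := L)
  have : ∀ p : F[X], aeval (algebraMap (RatFunc F) L RatFunc.X) p = iotaL F L p := by
    intro p
    induction p using Polynomial.induction_on' with
    | add p q hp hq => rw [map_add, map_add, hp, hq]
    | monomial n a => 
      rw [← C_mul_X_pow_eq_monomial]
      simp only [map_mul, aeval_C, map_pow, aeval_X, iotaL_C, iotaL_X]
  rw [← this, ← this]; exact hab

theorem exists_hom_of_transc (x y : L) (hxy : ((shortWeierstrass F A B)⁄L).Nonsingular x y)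
    (hx : Transcendental F x) : ∃ ρ : L →ₐ[F] L, Point.map ρ S.g = Point.some x y hxy := by
  have hinj : Function.Injective (aeval x : F[X] →ₐ[F] L) := transcendental_iff_injective.1 hx
  let i : RatFunc F →ₐ[F] L := RatFunc.liftAlgHom (aeval x) (by
    intro p hp
    rw [Submonoid.mem_comap, mem_nonZeroDivisors_iff_ne_zero]
    exact (map_ne_zero_iff _ hinj).2 (nonZeroDivisors.ne_zero hp))
  have hi : ∀ p : F[X], i (algebraMap _ _ p) = aeval x p := fun p => by
    have := RatFunc.liftAlgHom_apply_div (aeval x : F[X] →ₐ[F] L) (by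
      intro p hp
      rw [Submonoid.mem_comap, mem_nonZeroDivisors_iff_ne_zero]
      exact (map_ne_zero_iff _ hinj).2 (nonZeroDivisors.ne_zero hp)) p 1
    rw [map_one, map_one, div_one, div_one] at this
    exact this
  obtain ⟨ρ, h1, h2⟩ := S.hlift i y (by
    rw [hi]
    have := (equation_iff x y).1 hxy.1
    simp [shortWeierstrass] at this
    simp [this])
  refine ⟨ρ, ?_⟩
  rw [g, Point.map_some]
  have : ρ (algebraMap (RatFunc F) L RatFunc.X) = x := by
    rw [h1, ← RatFunc.algebraMap_X, hi, aeval_X]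
  simp [this, h2]

theorem hom_ext (ρ τ : L →ₐ[F] L) (h : Point.map ρ S.g = Point.map τ S.g) : ρ = τ := by
  rw [g, Point.map_some, Point.map_some] at h
  simp only [Point.some.injEq] at h
  obtain ⟨h1, h2⟩ := h
  have hp : ∀ p : F[X], ρ (iotaL F L p) = τ (iotaL F L p) := by
    intro p
    induction p using Polynomial.induction_on' with
    | add p q hp hq => simp only [map_add, hp, hq]
    | monomial n a => 
      rw [← C_mul_X_pow_eq_monomial]
      simp only [map_mul, map_pow, iotaL_C, iotaL_X, AlgHom.commutes, h1]
  have hk : ∀ k : RatFunc F, ρ (algebraMap _ L k) = τ (algebraMap _ L k) := by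
    intro k
    have e : algebraMap _ L k = iotaL F L k.num / iotaL F L k.denom := by
      conv_lhs => rw [← k.num_div_denom]
      rw [map_div₀]; rfl
    rw [e, map_div₀, map_div₀, hp, hp]
  ext z
  obtain ⟨a, b, rfl⟩ := S.hspan z
  rw [map_add, map_mul, map_add, map_mul, hk, hk, h2]

theorem const_of_alg (x y : L) (hxy : ((shortWeierstrass F A B)⁄L).Nonsingular x y)
    (hx : IsAlgebraic F x) :
    ∃ P : ((shortWeierstrass F A B)⁄(algebraicClosure F L)).Point,
      Point.map ((algebraicClosure F L).val) P = Point.some x y hxy := by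
  have hy : IsAlgebraic F y := by
    have := (equation_iff x y).1 hxy.1
    simp [shortWeierstrass] at this
    refine IsAlgebraic.of_pow (n := 2) (by norm_num) ?_
    rw [this]
    exact ((hx.pow 3).add ((isAlgebraic_algebraMap A).mul hx)).add (isAlgebraic_algebraMap B)
  refine ⟨Point.some (⟨x, mem_algebraicClosure_iff.2 hx⟩ : algebraicClosure F L)
    (⟨y, mem_algebraicClosure_iff.2 hy⟩ : algebraicClosure F L) ?_, ?_⟩
  · exact (((shortWeierstrass F A B)).baseChange_nonsingular ((algebraicClosure F L).val).injective _ _).1 hxy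
  · rw [Point.map_some]; simp

theorem not_const (P : ((shortWeierstrass F A B)⁄(algebraicClosure F L)).Point) :
    Point.map ((algebraicClosure F L).val) P ≠ S.g := by
  intro h
  rcases P with _ | ⟨x, y, hP⟩
  · rw [← Point.zero_def, map_zero] at h
    exact Point.some_ne_zero _ h.symm
  · rw [Point.map_some, g] at h
    simp only [Point.some.injEq] at h
    apply t_transc (F := F) (L := L)
    rw [← h.1]
    exact mem_algebraicClosure_iff.1 x.2

theorem base_eq (T : ((shortWeierstrass F A B)⁄F).Point) :
    Point.map ((algebraicClosure F L).val) (Point.baseChange F (algebraicClosure F L) T) =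
      Point.baseChange F L T := Point.map_baseChange _ _

theorem exists_hom (ε : ℤˣ) (T : ((shortWeierstrass F A B)⁄F).Point) :
    ∃ ρ : L →ₐ[F] L, Point.map ρ S.g = (ε : ℤ) • S.g + Point.baseChange F L T := by
  have key : ∀ P : ((shortWeierstrass F A B)⁄(algebraicClosure F L)).Point,
      Point.map ((algebraicClosure F L).val) P ≠ (ε : ℤ) • S.g + Point.baseChange F L T := by
    intro P hP
    apply S.not_const ((ε : ℤ) • (P - Point.baseChange F (algebraicClosure F L) T))
    rw [map_zsmul, map_sub, hP, base_eq, add_sub_cancel_right, smul_smul, ← Units.val_mul,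
      Int.units_mul_self]
    simp
  rcases hR : (ε : ℤ) • S.g + Point.baseChange F L T with _ | ⟨x, y, hxy⟩
  · exact absurd (by rw [hR, ← Point.zero_def, map_zero]) (key 0)
  · apply S.exists_hom_of_transc
    intro hx
    obtain ⟨P, hP⟩ := const_of_alg x y hxy hx
    exact key P (hP.trans hR.symm)

theorem map_base (ρ : L →ₐ[F] L) (T : ((shortWeierstrass F A B)⁄F).Point) :
    Point.map ρ (Point.baseChange F L T) = Point.baseChange F L T := Point.map_baseChange _ _

theorem map_comp (ρ τ : L →ₐ[F] L) (P : ((shortWeierstrass F A B)⁄L).Point) :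
    Point.map ρ (Point.map τ P) = Point.map (ρ.comp τ) P := Point.map_map _ _ _

theorem map_one' (P : ((shortWeierstrass F A B)⁄L).Point) :
    Point.map (AlgHom.id F L) P = P := by
  rcases P with _ | ⟨x, y, hP⟩ <;> rfl

theorem exists_equiv (ε : ℤˣ) (T : ((shortWeierstrass F A B)⁄F).Point) :
    ∃ ρ : L ≃ₐ[F] L, Point.map (ρ : L →ₐ[F] L) S.g = (ε : ℤ) • S.g + Point.baseChange F L T := by
  obtain ⟨ρ, hρ⟩ := S.exists_hom ε T
  obtain ⟨τ, hτ⟩ := S.exists_hom ε (-((ε : ℤ) • T))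
  have he : ∀ P : ((shortWeierstrass F A B)⁄L).Point, (ε : ℤ) • (ε : ℤ) • P = P := by
    intro P; rw [smul_smul, ← Units.val_mul, Int.units_mul_self]; simp
  have h1 : ρ.comp τ = AlgHom.id F L := by
    apply S.hom_ext
    rw [← map_comp, hτ, map_add, map_zsmul, hρ, map_base, map_one', smul_add, he, map_neg, map_zsmul]
    abel
  have h2 : τ.comp ρ = AlgHom.id F L := by
    apply S.hom_ext
    rw [← map_comp, hρ, map_add, map_zsmul, hτ, map_base, map_one', smul_add, he, map_neg, map_zsmul, smul_neg, he]
    abel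
  exact ⟨AlgEquiv.ofAlgHom ρ τ h1 h2, hρ⟩

end
end EllSetup


theorem aux_tower {F K L : Type} [Field F] [Field K] [Field L] [Algebra F K] [Algebra K L]
    (K0 : IntermediateField F K) (M : Subfield L) (h : ∀ k ∈ K0, algebraMap K L k ∈ M) :
    Module.finrank M L ∣ Module.finrank K0 K * Module.finrank K L := by
  let f : K0 →+* M := ((algebraMap K L).comp (algebraMap K0 K)).codRestrict M (fun k => h _ k.2)
  letI : Algebra K0 M := f.toAlgebra
  haveI : IsScalarTower K0 M L := IsScalarTower.of_algebraMap_eq (fun k => rfl)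
  rw [Module.finrank_mul_finrank, ← Module.finrank_mul_finrank K0 M L]
  exact dvd_mul_left _ _

namespace EllSetup
section
variable {F L : Type} [Field F] [Field L] [Algebra F L] [Algebra (RatFunc F) L]
    [IsScalarTower F (RatFunc F) L] {A B : F} (S : EllSetup F L A B) [DecidableEq F] [DecidableEq L]

theorem he (ε : ℤˣ) (P : ((shortWeierstrass F A B)⁄L).Point) : (ε : ℤ) • (ε : ℤ) • P = P := by
  rw [smul_smul, ← Units.val_mul, Int.units_mul_self]; simp

/-- The group of automorphisms `g ↦ ± g + T`. -/
def HH : Subgroup (L ≃ₐ[F] L) where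
  carrier := {ρ | ∃ (ε : ℤˣ) (T : ((shortWeierstrass F A B)⁄F).Point),
    Point.map (ρ : L →ₐ[F] L) S.g = (ε : ℤ) • S.g + Point.baseChange F L T}
  one_mem' := ⟨1, 0, by
    rw [map_zero, Units.val_one, one_smul, add_zero]
    exact map_one' _⟩
  mul_mem' := by
    rintro ρ τ ⟨ε, T, h⟩ ⟨ε', T', h'⟩
    refine ⟨ε' * ε, (ε' : ℤ) • T + T', ?_⟩
    have e : ((ρ * τ : L ≃ₐ[F] L) : L →ₐ[F] L) = (ρ : L →ₐ[F] L).comp (τ : L →ₐ[F] L) := rfl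
    rw [e, ← map_comp, h', map_add, map_zsmul, h, map_base, smul_add, smul_smul, map_add, map_zsmul,
      Units.val_mul]
    abel
  inv_mem' := by
    rintro ρ ⟨ε, T, h⟩
    refine ⟨ε, -((ε : ℤ) • T), ?_⟩
    have e : ((ρ⁻¹ : L ≃ₐ[F] L) : L →ₐ[F] L).comp (ρ : L →ₐ[F] L) = AlgHom.id F L := by
      ext z; exact ρ.symm_apply_apply z
    have h2 := congrArg (Point.map ((ρ⁻¹ : L ≃ₐ[F] L) : L →ₐ[F] L)) h
    rw [map_comp, e, map_one', map_add, map_zsmul, map_base] at h2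
    rw [map_neg, map_zsmul, eq_comm, ← sub_eq_add_neg, ← smul_sub]
    rw [sub_eq_of_eq_add h2, he]

variable [Fintype F]

theorem two_g_ne [Finite ((shortWeierstrass F A B)⁄F).Point] (T : ((shortWeierstrass F A B)⁄F).Point) :
    (2 : ℤ) • S.g ≠ Point.baseChange F L T := by
  intro h
  set N := Nat.card ((shortWeierstrass F A B)⁄F).Point
  have hN : 0 < N := Nat.card_pos
  have h0 : (N : ℤ) • (2 : ℤ) • S.g = 0 := by
    rw [h, ← map_zsmul, natCast_zsmul, card_nsmul_eq_zero', map_zero]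
  have e1 : S.Pn (N * 2) = S.Pn 0 := by
    rw [Pn, Pn, mul_smul, h0]; simp
  have e2 : S.Pn (- (N * 2)) = S.Pn 0 := by
    rw [Pn, Pn, neg_smul, mul_smul, h0]; simp
  obtain ⟨d1, g1, f1⟩ := S.good_formula (N * 2)
  obtain ⟨d2, g2, f2⟩ := S.good_formula (-(N * 2))
  rw [e1] at g1
  rw [e2] at g2
  have k1 := g1.unique S.good_zero
  have k2 := g2.unique S.good_zero
  subst k1
  subst k2
  have : (N : ℤ) ^ 2 = 0 := by linarith
  have : (N : ℤ) = 0 := by simpa using this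
  omega

theorem base_inj : Function.Injective (Point.baseChange (W' := shortWeierstrass F A B) F L) :=
  Point.map_injective _

theorem card_HH [Finite ((shortWeierstrass F A B)⁄F).Point] :
    Nat.card S.HH = 2 * Nat.card ((shortWeierstrass F A B)⁄F).Point := by
  have hz : Nat.card ℤˣ = 2 := by simp
  rw [← hz, ← Nat.card_prod]
  symm
  choose Φ hΦ using S.exists_equiv
  apply Nat.card_congr
  refine Equiv.ofBijective (fun x => (⟨Φ x.1 x.2, x.1, x.2, hΦ x.1 x.2⟩ : S.HH)) ⟨?_, ?_⟩
  · rintro ⟨ε, T⟩ ⟨ε', T'⟩ h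
    have h1 : Φ ε T = Φ ε' T' := congrArg Subtype.val h
    have h2 := hΦ ε T
    rw [h1, hΦ] at h2
    have hee : ε = ε' := by
      by_contra hne
      have : (ε = 1 ∧ ε' = -1) ∨ (ε = -1 ∧ ε' = 1) := by
        rcases Int.units_eq_one_or ε with h | h <;> rcases Int.units_eq_one_or ε' with h' | h' <;> simp_all
      rcases this with ⟨rfl, rfl⟩ | ⟨rfl, rfl⟩
      · apply S.two_g_ne (T' - T)
        simp only [Units.val_one, Units.val_neg, one_smul, neg_smul] at h2
        rw [map_sub, two_zsmul, eq_sub_iff_add_eq, add_assoc, ← h2, add_neg_cancel_left]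
      · apply S.two_g_ne (T - T')
        simp only [Units.val_one, Units.val_neg, one_smul, neg_smul] at h2
        rw [map_sub, two_zsmul, eq_sub_iff_add_eq, add_assoc, h2, add_neg_cancel_left]
    subst hee
    rw [add_right_inj] at h2
    rw [base_inj h2]
  · rintro ⟨ρ, ε, T, h⟩
    refine ⟨⟨ε, T⟩, ?_⟩
    apply Subtype.ext
    apply AlgEquiv.coe_toAlgHom_injective
    apply S.hom_ext
    exact (hΦ _ _).trans h.symm

theorem HH_fix (e : ℕ) (hT : ∀ T : ((shortWeierstrass F A B)⁄F).Point, e • T = 0) (n : ℤ)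
    (hn : (e : ℤ) ∣ 1 - n) (ρ : L ≃ₐ[F] L) (hρ : ρ ∈ S.HH) :
    Point.map (ρ : L →ₐ[F] L) (S.Pn n) = S.Pn n ∨ Point.map (ρ : L →ₐ[F] L) (S.Pn n) = - S.Pn n := by
  obtain ⟨ε, T, h⟩ := hρ
  have h0 : (1 - n) • T = 0 := by
    obtain ⟨k, hk⟩ := hn
    rw [hk, mul_comm, mul_smul, natCast_zsmul, hT, smul_zero]
  have h1 : Point.map (ρ : L →ₐ[F] L) (S.Pn n) = (ε : ℤ) • S.Pn n := by
    have h2 : Point.baseChange F L T - n • Point.baseChange F L T = 0 := by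
      rw [← map_zsmul, ← map_sub, ← map_zero (Point.baseChange F L), ← h0, sub_smul, one_smul]
    rw [Pn, map_sub, map_zsmul, map_frob, h, map_add, map_zsmul, map_base, smul_sub, smul_add,
      smul_comm n (ε : ℤ)]
    rw [add_sub_add_comm, h2, add_zero]
  rw [h1]
  rcases Int.units_eq_one_or ε with rfl | rfl
  · left; simp
  · right; simp

theorem dvd_deg [Finite ((shortWeierstrass F A B)⁄F).Point]
    (e : ℕ) (hT : ∀ T : ((shortWeierstrass F A B)⁄F).Point, e • T = 0) (n : ℤ)
    (hn : (e : ℤ) ∣ 1 - n) (d : ℕ) (hd : GoodDeg (S.Pn n) d) :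
    Nat.card ((shortWeierstrass F A B)⁄F).Point ∣ d := by
  obtain ⟨u, v, ⟨hc, l, lu, lv⟩, hlt, rfl⟩ := hd
  have hfix := S.HH_fix e hT n hn
  rcases hP : S.Pn n with _ | ⟨x, y, hxy⟩
  · rw [hP, ← Point.zero_def] at lv
    have hv : v = 0 := by
      apply iotaL_inj (L := L)
      rw [lv, map_zero]; simp
    rw [hv, isCoprime_zero_right] at hc
    rw [natDegree_eq_zero_of_isUnit hc]
    exact dvd_zero _
  rw [hP] at lu lv hfix
  simp only [Point.xRep_some, Matrix.cons_val_zero, Matrix.cons_val_one, mul_one] at lu lv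
  have hv0 : v ≠ 0 := by
    rintro rfl
    rw [map_zero] at lv
    rw [← lv, zero_mul] at lu
    have hu : u = 0 := iotaL_inj (L := L) (by rw [lu, map_zero])
    rw [hu] at hlt
    simp at hlt
  have hιv : iotaL F L v ≠ 0 := (map_ne_zero_iff _ iotaL_inj).2 hv0
  set r : RatFunc F := algebraMap F[X] (RatFunc F) u / algebraMap F[X] (RatFunc F) v with hr
  have hx : algebraMap (RatFunc F) L r = x := by
    rw [hr, map_div₀]
    change iotaL F L u / iotaL F L v = x
    rw [div_eq_iff hιv, lu, lv, mul_comm]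
  have hrn : max r.num.natDegree r.denom.natDegree = u.natDegree := by
    have e : r.num * v = u * r.denom := by
      apply RatFunc.algebraMap_injective F
      rw [map_mul, map_mul]
      have h1 := r.num_div_denom
      rw [div_eq_iff (by simpa using r.denom_ne_zero)] at h1
      rw [h1, hr, div_mul_eq_mul_div, div_mul_cancel₀]
      simpa using hv0
    have hc' := r.isCoprime_num_denom
    have a1 : Associated u r.num := associated_of_dvd_dvd
      (hc.dvd_of_dvd_mul_right (Dvd.intro _ e.symm)) (hc'.dvd_of_dvd_mul_right (Dvd.intro _ e))
    have a2 : Associated v r.denom := associated_of_dvd_dvd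
      (hc.symm.dvd_of_dvd_mul_left (Dvd.intro_left _ e)) (hc'.symm.dvd_of_dvd_mul_left (Dvd.intro_left _ e.symm))
    rw [← natDegree_eq_of_degree_eq (degree_eq_degree_of_associated a1),
      ← natDegree_eq_of_degree_eq (degree_eq_degree_of_associated a2)]
    exact max_eq_left (natDegree_le_natDegree hlt.le)
  have hxfix : ∀ ρ : S.HH, (ρ : L ≃ₐ[F] L) x = x := by
    intro ρ
    have := hfix ρ ρ.2
    rw [Point.map_some, Point.neg_some] at this
    simp only [Point.some.injEq] at this
    rcases this with h | h <;> exact h.1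
  have hfin : Finite S.HH := Nat.finite_of_card_ne_zero (by rw [S.card_HH]; have : 0 < Nat.card ((shortWeierstrass F A B)⁄F).Point := Nat.card_pos
                                                            omega)
  have := Fintype.ofFinite S.HH
  have hart := FixedPoints.finrank_eq_card S.HH L
  rw [← Nat.card_eq_fintype_card, card_HH] at hart
  have hK := RatFunc.finrank_eq_max_natDegree r
  rw [hrn] at hK
  have key := aux_tower (IntermediateField.adjoin F {r}) (FixedPoints.subfield S.HH L) (by
    intro k hk
    have hle : IntermediateField.adjoin F {r} ≤
      ({ ((FixedPoints.subfield S.HH L).comap (algebraMap (RatFunc F) L)) with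
        algebraMap_mem' := fun c ρ => by
          change (ρ : L ≃ₐ[F] L) (algebraMap (RatFunc F) L (algebraMap F (RatFunc F) c)) = _
          rw [← IsScalarTower.algebraMap_apply]
          exact (ρ : L ≃ₐ[F] L).commutes c } : IntermediateField F (RatFunc F)) := by
      rw [IntermediateField.adjoin_le_iff, Set.singleton_subset_iff]
      intro ρ
      rw [hx]
      exact hxfix ρ
    exact hle hk)
  rw [hart, hK, S.hrank, mul_comm u.natDegree] at key
  exact Nat.dvd_of_mul_dvd_mul_left two_pos key
end
end EllSetup


section
variable {F : Type} [Field F] (A B : F)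

/-- The cubic as a rational function. -/
noncomputable def ffR : RatFunc F := algebraMap F[X] (RatFunc F) (X ^ 3 + C A * X + C B)

theorem ff_natDegree : ((X : F[X]) ^ 3 + C A * X + C B).natDegree = 3 := by
  compute_degree!

theorem ffR_not_sq (r : RatFunc F) : r ^ 2 ≠ ffR A B := by
  intro h
  have h1 := r.num_div_denom
  rw [← h1, div_pow, ffR, div_eq_iff (by simpa using r.denom_ne_zero), ← map_pow, ← map_pow, ← map_mul] at h
  have h3 := congrArg natDegree (RatFunc.algebraMap_injective F h)
  have hf := ff_natDegree A B
  have hf0 : (X : F[X]) ^ 3 + C A * X + C B ≠ 0 := by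
    intro h0; rw [h0] at hf; simp at hf
  rw [natDegree_mul hf0 (pow_ne_zero _ r.denom_ne_zero), hf, natDegree_pow, natDegree_pow] at h3
  omega

/-- The defining polynomial of the function field. -/
noncomputable def ffP : (RatFunc F)[X] := X ^ 2 - C (ffR A B)

theorem ffP_monic : (ffP A B).Monic := monic_X_pow_sub_C _ two_ne_zero

theorem ffP_natDegree : (ffP A B).natDegree = 2 := natDegree_X_pow_sub_C

theorem ffP_irr : Irreducible (ffP A B) :=
  X_pow_sub_C_irreducible_of_prime Nat.prime_two (ffR_not_sq A B)

instance ffP_fact : Fact (Irreducible (ffP A B)) := ⟨ffP_irr A B⟩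

theorem ffP_eval {R : Type} [CommRing R] (i : RatFunc F →+* R) (x : R) :
    (ffP A B).eval₂ i x = x ^ 2 - i (ffR A B) := by
  simp [ffP]

theorem ffP_root_sq : (AdjoinRoot.root (ffP A B)) ^ 2 = algebraMap (RatFunc F) _ (ffR A B) := by
  have h := AdjoinRoot.eval₂_root (ffP A B)
  rw [ffP_eval, sub_eq_zero] at h
  exact h

theorem sw_Δ : (shortWeierstrass F A B).Δ = -16 * (4 * A ^ 3 + 27 * B ^ 2) := by
  simp [shortWeierstrass, WeierstrassCurve.Δ, WeierstrassCurve.b₂, WeierstrassCurve.b₄,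
    WeierstrassCurve.b₆, WeierstrassCurve.b₈]
  ring

/-- The function field of the curve. -/
noncomputable def theSetup (h2 : (2 : F) ≠ 0) (hd : 4 * A ^ 3 + 27 * B ^ 2 ≠ 0) :
    EllSetup F (AdjoinRoot (ffP A B)) A B where
  w := AdjoinRoot.root _
  h2 := h2
  hd := hd
  hw := ffP_root_sq A B
  hspan := by
    intro z
    obtain ⟨q, rfl⟩ := AdjoinRoot.mk_surjective z
    have h1 := modByMonic_add_div q (ffP A B)
    have h2 : (q %ₘ ffP A B).natDegree < 2 := by
      rw [← ffP_natDegree A B]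
      apply natDegree_modByMonic_lt _ (ffP_monic A B)
      intro h
      have := ffP_natDegree A B
      rw [h] at this; simp at this
    obtain ⟨a, b, hab⟩ := exists_eq_X_add_C_of_natDegree_le_one (Nat.lt_succ_iff.1 h2)
    refine ⟨b, a, ?_⟩
    rw [← h1, map_add, map_mul, AdjoinRoot.mk_self, zero_mul, add_zero, hab]
    simp only [map_add, map_mul, AdjoinRoot.mk_C, AdjoinRoot.mk_X, AdjoinRoot.algebraMap_eq]
    rw [add_comm]
  hnm := by
    intro a h
    have h1 := ffP_root_sq A B
    rw [← h, ← map_pow] at h1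
    exact ffR_not_sq A B a ((algebraMap (RatFunc F) (AdjoinRoot (ffP A B))).injective h1)
  hrank := by
    rw [(AdjoinRoot.powerBasis (ffP_irr A B).ne_zero).finrank, AdjoinRoot.powerBasis_dim, ffP_natDegree]
  hlift := by
    intro i w' h
    refine ⟨AdjoinRoot.liftAlgHom (ffP A B) i w' ?_, ?_, ?_⟩
    · rw [ffP_eval, sub_eq_zero, h]; rfl
    · intro k
      simp
    · simp
  hns := by
    rw [← equation_iff_nonsingular_of_Δ_ne_zero]
    · rw [equation_iff]
      have := ffP_root_sq A B
      simp only [ffR, map_add, map_mul, map_pow, RatFunc.algebraMap_X, RatFunc.algebraMap_C] at this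
      simp [shortWeierstrass, this]
      rfl
    · rw [show WeierstrassCurve.Δ (shortWeierstrass F A B)⁄(AdjoinRoot (ffP A B)) = algebraMap F _ (shortWeierstrass F A B).Δ from WeierstrassCurve.map_Δ _ _, sw_Δ, map_ne_zero_iff _ (algebraMap F _).injective]
      have : (-16 : F) = - 2 ^ 4 := by norm_num
      rw [this]
      exact mul_ne_zero (neg_ne_zero.2 (pow_ne_zero _ h2)) hd
end


open EllSetup
section
variable {F : Type} [Field F] [Fintype F] {A B : F}

theorem sw_eq : (shortWeierstrass F A B)⁄F = shortWeierstrass F A B := rfl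

theorem disc_ne (hΔ : (shortWeierstrass F A B).Δ ≠ 0) : (2 : F) ≠ 0 ∧ 4 * A ^ 3 + 27 * B ^ 2 ≠ 0 := by
  rw [sw_Δ] at hΔ
  refine ⟨fun h => hΔ ?_, fun h => hΔ ?_⟩
  · have : (-16 : F) = - 2 ^ 4 := by norm_num
    rw [this, h]; simp
  · rw [h, mul_zero]

/-- Points as optional solutions. -/
noncomputable def ptEquiv (hΔ : (shortWeierstrass F A B).Δ ≠ 0) :
    (shortWeierstrass F A B).Point ≃ Option ((x : F) × {y : F // y ^ 2 = x ^ 3 + A * x + B}) where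
  toFun P := match P with
    | .zero => none
    | .some x y h => some ⟨x, y, by
        have := (equation_iff _ _).1 h.1
        simpa [shortWeierstrass] using this⟩
  invFun o := match o with
    | none => .zero
    | some ⟨x, y, h⟩ => .some x y ((equation_iff_nonsingular_of_Δ_ne_zero hΔ).1 (by
        rw [equation_iff]
        simpa [shortWeierstrass] using h))
  left_inv P := by cases P <;> rfl
  right_inv o := by rcases o with _ | ⟨x, y, h⟩ <;> rfl

theorem pt_finite (hΔ : (shortWeierstrass F A B).Δ ≠ 0) : Finite (shortWeierstrass F A B).Point :=
  Finite.of_equiv _ (ptEquiv hΔ).symm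

theorem card_fib (h2 : (2 : F) ≠ 0) (x : F) : Nat.card {y : F // y ^ 2 = x ^ 3 + A * x + B} = ee A B x := by
  classical
  unfold ee
  set c := x ^ 3 + A * x + B with hc
  split_ifs with h h'
  · rw [h, Nat.card_eq_one_iff_unique]
    refine ⟨⟨fun a b => Subtype.ext ?_⟩, ⟨0, by simp⟩⟩
    rw [pow_eq_zero_iff two_ne_zero |>.1 a.2, pow_eq_zero_iff two_ne_zero |>.1 b.2]
  · obtain ⟨r, hr⟩ := h'
    have hr0 : r ≠ 0 := by rintro rfl; simp at hr; exact h hr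
    have : {y : F | y ^ 2 = c} = {r, -r} := by
      ext y
      simp only [Set.mem_ofPred_eq, Set.mem_insert_iff, Set.mem_singleton_iff]
      rw [hr, ← sq, sq_eq_sq_iff_eq_or_eq_neg]
    change Nat.card {y : F | y ^ 2 = c} = 2
    rw [this, Nat.card_coe_set_eq, Set.ncard_pair]
    intro hh
    have : 2 * r = 0 := by linear_combination hh
    rcases mul_eq_zero.1 this with h | h
    · exact h2 h
    · exact hr0 h
  · rw [Nat.card_eq_zero]
    left
    exact ⟨fun y => h' ⟨y.1, by have := y.2; rw [sq] at this; exact this.symm⟩⟩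

theorem card_pt (hΔ : (shortWeierstrass F A B).Δ ≠ 0) :
    Nat.card (shortWeierstrass F A B).Point = 1 + ∑ x, ee A B x := by
  rw [Nat.card_congr (ptEquiv hΔ), Finite.card_option, Nat.card_sigma, add_comm]
  congr 1
  exact Finset.sum_congr rfl fun x _ => card_fib (disc_ne hΔ).1 x

theorem curve_main [DecidableEq F] (hΔ : (shortWeierstrass F A B).Δ ≠ 0) (a : ℤ)
    (ha : a = Fintype.card F + 1 - Nat.card (shortWeierstrass F A B).Point) :
    (∀ n : ℤ, 0 ≤ n ^ 2 - a * n + Fintype.card F) ∧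
    ∀ e : ℕ, (∀ T : (shortWeierstrass F A B).Point, e • T = 0) →
      (Nat.card (shortWeierstrass F A B).Point : ℤ) ∣ e * (e + 2 - a) ∧
      (Nat.card (shortWeierstrass F A B).Point : ℤ) ∣ e * (e - (2 - a)) := by
  classical
  obtain ⟨h2, hd⟩ := disc_ne hΔ
  have S := theSetup A B h2 hd
  haveI : Finite ((shortWeierstrass F A B)⁄F).Point := pt_finite hΔ
  have hN := card_pt hΔ
  have hN' : (∑ x, (ee A B x : ℤ)) = Nat.card (shortWeierstrass F A B).Point - 1 := by
    rw [hN]; push_cast; ring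
  have haa : (Fintype.card F - ∑ x, (ee A B x : ℤ)) = a := by rw [hN', ha]; ring
  have gf := S.good_formula
  rw [haa] at gf
  refine ⟨fun n => ?_, fun e he => ?_⟩
  · obtain ⟨d, -, h⟩ := gf n
    rw [← h]; positivity
  · obtain ⟨d, hd, h⟩ := gf (1 + e)
    obtain ⟨d', hd', h'⟩ := gf (1 - e)
    have k := S.dvd_deg e (fun T => he T) (1 + e) ⟨-1, by ring⟩ d hd
    have k' := S.dvd_deg e (fun T => he T) (1 - e) ⟨1, by ring⟩ d' hd'
    change Nat.card (shortWeierstrass F A B).Point ∣ d at k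
    change Nat.card (shortWeierstrass F A B).Point ∣ d' at k'
    rw [← Int.natCast_dvd_natCast, h] at k
    rw [← Int.natCast_dvd_natCast, h'] at k'
    constructor
    · have := dvd_sub k (dvd_refl _)
      refine this.trans (dvd_of_eq ?_)
      rw [ha]; ring
    · have := dvd_sub k' (dvd_refl _)
      refine this.trans (dvd_of_eq ?_)
      rw [ha]; ring

theorem ee_twist (α : F) (hα : ¬ IsSquare α) (h2 : (2 : F) ≠ 0) (x : F) :
    ee ((α ^ 2)⁻¹ * A) ((α ^ 3)⁻¹ * B) x + ee A B (α * x) = 2 := by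
  classical
  have h0 : α ≠ 0 := by rintro rfl; exact hα (IsSquare.zero)
  unfold ee
  have e : x ^ 3 + (α ^ 2)⁻¹ * A * x + (α ^ 3)⁻¹ * B = (α ^ 3)⁻¹ * ((α * x) ^ 3 + A * (α * x) + B) := by
    field_simp
  rw [e]
  set c := (α * x) ^ 3 + A * (α * x) + B with hc
  by_cases hc0 : c = 0
  · simp [hc0]
  have hc1 : (α ^ 3)⁻¹ * c ≠ 0 := mul_ne_zero (inv_ne_zero (pow_ne_zero _ h0)) hc0
  rw [if_neg hc0, if_neg hc1]
  have : IsSquare ((α ^ 3)⁻¹ * c) ↔ ¬ IsSquare c := by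
    have e1 : IsSquare ((α ^ 3)⁻¹ * c) ↔ IsSquare (α * c) := by
      constructor
      · rintro ⟨r, hr⟩
        refine ⟨α ^ 2 * r, ?_⟩
        have : c = α ^ 3 * (r * r) := by rw [← hr]; field_simp
        rw [this]; ring
      · rintro ⟨r, hr⟩
        refine ⟨r / α ^ 2, ?_⟩
        have : c = r * r / α := by rw [← hr]; field_simp
        rw [this]; field_simp
    rw [e1]
    have hF : ringChar F ≠ 2 := by
      intro h
      apply h2
      have := ringChar.Nat.cast_ringChar (R := F)
      rw [h] at this
      exact_mod_cast this
    rw [← quadraticChar_one_iff_isSquare (mul_ne_zero h0 hc0), ← quadraticChar_one_iff_isSquare hc0, map_mul,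
      (quadraticChar_neg_one_iff_not_isSquare).2 hα]
    rcases quadraticChar_dichotomy hc0 with h | h <;> rw [h] <;> norm_num
  by_cases h : IsSquare c <;> simp [this, h]

theorem card_twist (α : F) (hα : ¬ IsSquare α) (hΔ : (shortWeierstrass F A B).Δ ≠ 0) :
    (shortWeierstrass F ((α ^ 2)⁻¹ * A) ((α ^ 3)⁻¹ * B)).Δ ≠ 0 ∧
    Nat.card (shortWeierstrass F ((α ^ 2)⁻¹ * A) ((α ^ 3)⁻¹ * B)).Point + 
      Nat.card (shortWeierstrass F A B).Point = 2 * Fintype.card F + 2 := by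
  have h0 : α ≠ 0 := by rintro rfl; exact hα (IsSquare.zero)
  have hΔ' : (shortWeierstrass F ((α ^ 2)⁻¹ * A) ((α ^ 3)⁻¹ * B)).Δ ≠ 0 := by
    have : (shortWeierstrass F ((α ^ 2)⁻¹ * A) ((α ^ 3)⁻¹ * B)).Δ = (α ^ 6)⁻¹ * (shortWeierstrass F A B).Δ := by
      rw [sw_Δ, sw_Δ]; field_simp
    rw [this]
    exact mul_ne_zero (inv_ne_zero (pow_ne_zero _ h0)) hΔ
  refine ⟨hΔ', ?_⟩
  rw [card_pt hΔ, card_pt hΔ']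
  have e : ∑ x, ee A B x = ∑ x, ee A B (α * x) := by
    exact (Equiv.sum_comp (Equiv.mulLeft₀ α h0) (ee A B)).symm
  have e2 : ∑ x, ee ((α ^ 2)⁻¹ * A) ((α ^ 3)⁻¹ * B) x + ∑ x, ee A B (α * x) = 2 * Fintype.card F := by
    rw [← Finset.sum_add_distrib, Finset.sum_congr rfl fun x _ => ee_twist α hα (disc_ne hΔ).1 x]
    simp [mul_comm]
  rw [e]; omega
end


/-- Range test for a tuple of parameters. -/
def chkA (m k c : ℕ) : Bool :=
  Nat.ble (47 + m * 10) (m * (m * k) + m * c) && (Nat.ble (m * (m * k) + m * c) (512 + m * 10) &&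
    (Nat.ble (c * c + 100) (4 * k + 20 * c) &&
    Nat.ble (m * k * (m * k) + 160 * m) (16 * (m * (m * k) + m * c + 1))))

/-- Divisor test for a tuple of parameters. -/
def chkB (m e M p c n : ℕ) : Bool :=
  !(Nat.beq (M % n) 0) || (!(Nat.beq ((2 * (M / n)) % n) 0) ||
    (!(Nat.beq ((M / n + 4 + m * c) % n) ((10 * m) % n)) ||
     (Nat.ble (16 * p + 1) (Nat.lcm e (M / n) ^ 2) || (Nat.beq p 49 || (Nat.beq p 51 || (Nat.beq p 55 ||
     (Nat.beq p 59 && (Nat.beq (m * c + 2) (10 * m) && Nat.beq e 30))))))))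

/-- Combined test. -/
def chkC (m k c : ℕ) : Bool :=
  !(chkA m k c) || (List.range 34).all
    (chkB m (m * k) (m * (m * k) + 2 * (m * c) + 4 - 20 * m) (m * (m * k) + m * c + 1 - 10 * m) c)

theorem chk_all : ∀ m < 24, ∀ k < 25, ∀ c < 20, chkC m k c = true := by
  decide +kernel


theorem arith_bound (p m e n f : ℕ) (a D : ℤ) (ha : a ^ 2 ≤ 4 * p)
    (hN : (m * e : ℤ) = p + 1 - a) (hM : (n * f : ℤ) = p + 1 + a)
    (h1 : (m : ℤ) ∣ 2 - a) (h1' : m ∣ e) (h2 : (n : ℤ) ∣ 2 * f) (h2' : (n : ℤ) ∣ 2 * (2 + a))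
    (hD : D ≠ 0) (hD1 : (e : ℤ) ∣ D) (hD2 : (f : ℤ) ∣ D) (hD3 : D ^ 2 ≤ 16 * p) : p ≤ 513 := by
  obtain ⟨c, hc⟩ := hD1
  obtain ⟨c', hc'⟩ := hD2
  have me : (m : ℤ) ∣ e := by exact_mod_cast h1'
  have k1 : (m : ℤ) ∣ 4 * c' := by
    have g4 : ((Int.gcd m f : ℕ) : ℤ) ∣ 4 := by
      have a1 : ((Int.gcd m f : ℕ) : ℤ) ∣ m := Int.gcd_dvd_left ..
      have a2 : ((Int.gcd m f : ℕ) : ℤ) ∣ f := Int.gcd_dvd_right ..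
      have b1 := a1.trans h1
      have b2 : ((Int.gcd m f : ℕ) : ℤ) ∣ p + 1 + a := hM ▸ a2.mul_left _
      have b3 : ((Int.gcd m f : ℕ) : ℤ) ∣ p + 1 - a := hN ▸ a1.mul_right _
      have := dvd_add (b1.mul_left 2) (dvd_sub b2 b3)
      refine this.trans (dvd_of_eq (by ring))
    have : (m : ℤ) ∣ f * c' := by rw [← hc', hc]; exact me.mul_right _
    have h3 : (m : ℤ) ∣ (Int.gcd m f : ℕ) * c' := by
      rw [Int.gcd_eq_gcd_ab, add_mul]
      refine dvd_add ⟨Int.gcdA m f * c', by ring⟩ ?_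
      refine this.trans ⟨Int.gcdB m f, by ring⟩
    exact h3.trans (mul_dvd_mul_right g4 _)
  have k2 : (n : ℤ) ∣ 8 * c := by
    have g4 : ((Int.gcd n e : ℕ) : ℤ) ∣ 4 := by
      have a1 : ((Int.gcd n e : ℕ) : ℤ) ∣ n := Int.gcd_dvd_left ..
      have a2 : ((Int.gcd n e : ℕ) : ℤ) ∣ e := Int.gcd_dvd_right ..
      have b1 := a1.trans h2'
      have b2 : ((Int.gcd n e : ℕ) : ℤ) ∣ p + 1 + a := hM ▸ a1.mul_right _
      have b3 : ((Int.gcd n e : ℕ) : ℤ) ∣ p + 1 - a := hN ▸ a2.mul_left _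
      have := dvd_sub b1 (dvd_sub b2 b3)
      refine this.trans (dvd_of_eq (by ring))
    have : (n : ℤ) ∣ e * (2 * c) := by
      have : (e * (2 * c) : ℤ) = 2 * f * c' := by linear_combination 2 * hc' - 2 * hc
      rw [this]; exact h2.mul_right _
    have h3 : (n : ℤ) ∣ (Int.gcd n e : ℕ) * (2 * c) := by
      rw [Int.gcd_eq_gcd_ab, add_mul]
      refine dvd_add ⟨Int.gcdA n e * (2 * c), by ring⟩ ?_
      refine this.trans ⟨Int.gcdB n e, by ring⟩
    refine (h3.trans (mul_dvd_mul_right g4 _)).trans (dvd_of_eq (by ring))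
  have k3 : ((m * e) * (n * f) : ℤ) ∣ 32 * D ^ 2 := by
    have := mul_dvd_mul (mul_dvd_mul k1 k2) (dvd_refl ((e : ℤ) * f))
    refine (dvd_of_eq (by ring)).trans (this.trans (dvd_of_eq ?_))
    have : D ^ 2 = (e * c) * (f * c') := by rw [← hc, ← hc']; ring
    rw [this]; ring
  have k4 := Int.le_of_dvd (by positivity) k3
  rw [hN, hM] at k4
  by_contra hp
  push Not at hp
  have hp' : (514 : ℤ) ≤ p := by exact_mod_cast hp
  nlinarith

set_option maxHeartbeats 1000000 in
theorem arith_main (p m k n f : ℕ) (hp : p.Prime) (hm : 0 < m) (hk : 0 < k) (hn : 0 < n) (hf : 0 < f)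
    (a s : ℤ) (ha : a ^ 2 ≤ 4 * p) (hs : s ^ 2 ≤ 4 * p)
    (hN : (m * (m * k : ℕ) : ℤ) = p + 1 - a) (hM : (n * f : ℤ) = p + 1 + a)
    (h1 : (m : ℤ) ∣ 2 - a) (h2 : (n : ℤ) ∣ f + 2 + a) (h2' : (n : ℤ) ∣ f - (2 + a))
    (has : a ≠ s) (hD1 : ((m * k : ℕ) : ℤ) ∣ a - s) (hD2 : (f : ℤ) ∣ a - s) : p ≤ 47 := by
  by_contra hp47
  push Not at hp47
  have hD : a - s ≠ 0 := sub_ne_zero.2 has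
  have hD3 : (a - s) ^ 2 ≤ 16 * p := by nlinarith [sq_nonneg (a + s)]
  have h2f : (n : ℤ) ∣ 2 * f := (dvd_add h2 h2').trans (dvd_of_eq (by ring))
  have h2a : (n : ℤ) ∣ 2 * (2 + a) := (dvd_sub h2 h2').trans (dvd_of_eq (by ring))
  have hp513 := arith_bound p m (m * k) n f a (a - s) ha hN hM h1 (dvd_mul_right _ _) h2f h2a hD hD1 hD2 hD3
  have hp48 : (48 : ℤ) ≤ p := by exact_mod_cast hp47
  have hp513' : (p : ℤ) ≤ 513 := by exact_mod_cast hp513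
  have hDpos : 0 < (a - s).natAbs := Int.natAbs_pos.2 hD
  have hl : Nat.lcm (m * k) f ∣ (a - s).natAbs :=
    Nat.lcm_dvd (Int.natCast_dvd.1 hD1) (Int.natCast_dvd.1 hD2)
  have hl2 : (Nat.lcm (m * k) f) ^ 2 ≤ 16 * p := by
    have := Nat.pow_le_pow_left (Nat.le_of_dvd hDpos hl) 2
    have h3 : (a - s).natAbs ^ 2 ≤ 16 * p := by
      zify; rw [sq_abs]; exact hD3
    exact this.trans h3
  have he2 : (m * k) ^ 2 ≤ 16 * p :=
    (Nat.pow_le_pow_left (Nat.le_of_dvd (Nat.lcm_pos (by positivity) hf) (Nat.dvd_lcm_left _ _)) 2).trans hl2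
  obtain ⟨b', hb'⟩ := h1
  obtain ⟨b, rfl⟩ : ∃ b, b' = -b := ⟨-b', by ring⟩
  have hab : a = 2 + m * b := by linarith
  subst hab
  clear hb'
  have hmz : (0 : ℤ) < m := by exact_mod_cast hm
  have hb2 : b ^ 2 ≤ 4 * k := by
    have : (m : ℤ) ^ 2 * b ^ 2 ≤ m ^ 2 * (4 * k) := by push_cast at hN; nlinarith
    exact le_of_mul_le_mul_left this (by positivity)
  have he2z : ((m : ℤ) * k) ^ 2 ≤ 16 * p := by exact_mod_cast he2
  push_cast at hN
  have ha3 : 3 * (2 + m * b) ≤ p + 3 := by nlinarith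
  have hk24 : k < 25 := by
    have : (m : ℤ) ^ 2 * k * k ≤ m ^ 2 * k * 24 := by nlinarith
    have hkz : (0 : ℤ) < k := by exact_mod_cast hk
    have := le_of_mul_le_mul_left this (by positivity)
    omega
  have hkz : (k : ℤ) ≤ 24 := by omega
  obtain ⟨hb10', hb10⟩ := abs_lt.1 (abs_lt_of_sq_lt_sq (show b ^ 2 < 10 ^ 2 by linarith) (by norm_num))
  obtain ⟨haL, haU⟩ := abs_lt.1 (abs_lt_of_sq_lt_sq
    (show (2 + m * b : ℤ) ^ 2 < 46 ^ 2 by linarith) (by norm_num))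
  have hkz1 : (1 : ℤ) ≤ k := by exact_mod_cast hk
  have hm24 : m < 24 := by
    by_contra h
    push Not at h
    have : (24 : ℤ) ≤ m := by exact_mod_cast h
    nlinarith [mul_le_mul this this (by norm_num) (by positivity)]
  have hn34 : n < 34 := by
    by_contra h
    push Not at h
    have h3 : (34 : ℤ) ≤ n := by exact_mod_cast h
    have h4 := Int.le_of_dvd (by positivity) h2f
    nlinarith
  obtain ⟨c, hc⟩ : ∃ c : ℕ, (c : ℤ) = b + 10 := ⟨(b + 10).toNat, by omega⟩
  have hc20 : c < 20 := by omega
  obtain rfl : b = c - 10 := by omega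
  have hchk := chk_all m hm24 k hk24 c hc20
  have hpN : m * (m * k) + m * c + 1 - 10 * m = p := by
    have : m * (m * k) + m * c + 1 = p + 10 * m := by zify; linarith
    omega
  have hMN : m * (m * k) + 2 * (m * c) + 4 - 20 * m = n * f := by
    have : m * (m * k) + 2 * (m * c) + 4 = n * f + 20 * m := by zify; linarith
    omega
  have hA : chkA m k c = true := by
    simp only [chkA, Bool.and_eq_true, Nat.ble_eq]
    refine ⟨?_, ?_, ?_, ?_⟩
    · zify; linarith
    · zify; linarith
    · zify; linarith
    · zify; linarith
  rw [chkC, hA, hpN, hMN] at hchk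
  simp only [Bool.not_true, Bool.false_or, List.all_eq_true, List.mem_range] at hchk
  have hB := hchk n hn34
  have hdiv : n * f / n = f := Nat.mul_div_cancel_left _ hn
  simp only [chkB, hdiv, Nat.mul_mod_right, Bool.or_eq_true, Bool.and_eq_true, Bool.not_eq_true', Nat.beq_eq, Nat.ble_eq,
    ← Bool.not_eq_true] at hB
  rcases hB with h | h | h | h | h | h | h | ⟨h, h', h''⟩
  · simp at h
  · exact h (Nat.mod_eq_zero_of_dvd (by exact_mod_cast h2f))
  · apply h
    have : (n : ℤ) ∣ ((10 * m : ℕ) : ℤ) - ((f + 4 + m * c : ℕ) : ℤ) := by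
      rw [← dvd_neg]
      refine h2.trans (dvd_of_eq ?_)
      push_cast; ring
    exact (Nat.modEq_iff_dvd.2 this)
  · omega
  · rw [h] at hp; norm_num at hp
  · rw [h] at hp; norm_num at hp
  · rw [h] at hp; norm_num at hp
  · subst h
    have h3 : (2 + m * (c - 10 : ℤ)) = 0 := by zify at h'; linarith
    rw [h3] at hD1
    rw [h''] at hD1
    have hs0 : s ≠ 0 := by intro h0; apply has; rw [h3, h0]
    have h4 : (30 : ℤ) ∣ s := by simpa using hD1
    have h5 := Int.le_of_dvd (by positivity) ((abs_dvd_abs (30 : ℤ) s).2 h4)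
    have : |(30 : ℤ)| = 30 := rfl
    rw [this] at h5
    have h6 := sq_abs s
    norm_num at hs
    nlinarith


theorem small_check : ∀ p < 48, 3 ≤ p → ∀ N < 64, (p + 1) ^ 2 + N ^ 2 ≤ 4 * p + 2 * (p + 1) * N →
    N ^ 2 < 81 * p ∧ p ^ 3 < 100 * N ^ 2 := by
  decide +kernel

theorem hasse_of (q : ℕ) (hq : q.Prime) (hq2 : q ≠ 2) (a : ℤ) (h : ∀ n : ℤ, 0 ≤ n ^ 2 - a * n + q) :
    a ^ 2 ≤ 4 * q := by
  rcases Int.even_or_odd' a with ⟨t, rfl | rfl⟩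
  · have := h t
    nlinarith
  · have h1 := h (t + 1)
    have h2 : t * (t + 1) ≤ q := by linarith
    rcases h2.lt_or_eq with h2 | h2
    · nlinarith
    · exfalso
      have h3 : Even (q : ℤ) := h2 ▸ Int.even_mul_succ_self t
      have h4 : Even q := by exact_mod_cast h3
      exact hq2 ((hq.even_iff).1 h4)

theorem final_bounds (p m k : ℕ) (h3 : 3 ≤ p) (hp : p ≤ 47) (hm : 0 < m) (hk : 0 < k) (a : ℤ)
    (ha : a ^ 2 ≤ 4 * p) (hN : (m * (m * k : ℕ) : ℤ) = p + 1 - a) :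
    Real.sqrt p / 8 - 1 / 2 < (k : ℝ) ∧
      (m : ℝ) < 3 * (p : ℝ) ^ ((1 : ℝ) / 4) ∧
      (p : ℝ) ^ ((3 : ℝ) / 4) / Real.sqrt 10 < ((m : ℝ) * (k : ℝ)) := by
  have hpz : (p : ℤ) ≤ 47 := by exact_mod_cast hp
  obtain ⟨haL, haU⟩ := abs_lt.1 (abs_lt_of_sq_lt_sq (show a ^ 2 < 14 ^ 2 by linarith) (by norm_num))
  have hN64 : m * (m * k) < 64 := by zify; push_cast at hN; linarith
  obtain ⟨c1, c2⟩ := small_check p (by omega) h3 (m * (m * k)) hN64 (by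
    zify
    push_cast at hN
    obtain rfl : a = p + 1 - m * (m * k) := by linarith
    nlinarith)
  have hp0 : (0 : ℝ) ≤ p := Nat.cast_nonneg p
  refine ⟨?_, ?_, ?_⟩
  · have h1 : Real.sqrt p < 12 := by
      rw [Real.sqrt_lt' (by norm_num)]
      have : (p : ℝ) ≤ 47 := by exact_mod_cast hp
      linarith
    have h2 : (1 : ℝ) ≤ k := by exact_mod_cast hk
    linarith
  · have h1 : m ^ 4 < 81 * p := by
      refine lt_of_le_of_lt ?_ c1
      have : m * m ≤ m * (m * k) := Nat.mul_le_mul_left _ (Nat.le_mul_of_pos_right _ hk)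
      calc m ^ 4 = (m * m) ^ 2 := by ring
        _ ≤ _ := Nat.pow_le_pow_left this 2
    have h2 : (m : ℝ) ^ 4 < 81 * p := by exact_mod_cast h1
    apply lt_of_pow_lt_pow_left₀ 4 (by positivity)
    rw [mul_pow, ← Real.rpow_natCast ((p : ℝ) ^ ((1 : ℝ) / 4)), ← Real.rpow_mul hp0]
    norm_num
    exact h2
  · have h1 : p ^ 3 < 100 * (m * k) ^ 4 := by
      refine lt_of_lt_of_le c2 ?_
      have : m * (m * k) ≤ (m * k) ^ 2 := by
        rw [sq]
        exact Nat.mul_le_mul_right _ (Nat.le_mul_of_pos_right _ hk)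
      calc _ ≤ 100 * ((m * k) ^ 2) ^ 2 := Nat.mul_le_mul_left _ (Nat.pow_le_pow_left this 2)
        _ = _ := by ring
    have h2 : (p : ℝ) ^ 3 < 100 * (m * k : ℝ) ^ 4 := by exact_mod_cast h1
    rw [div_lt_iff₀ (by positivity)]
    apply lt_of_pow_lt_pow_left₀ 4 (by positivity)
    have h10 : Real.sqrt 10 ^ 4 = 100 := by
      rw [show (4 : ℕ) = 2 * 2 from rfl, pow_mul, Real.sq_sqrt (by norm_num)]; norm_num
    rw [mul_pow, h10, ← Real.rpow_natCast ((p : ℝ) ^ ((3 : ℝ) / 4)), ← Real.rpow_mul hp0]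
    norm_num
    linarith

/-- Under the annihilation hypotheses with `0 < |σ - p - 1| ≤ 2√p`, `#E(𝔽_p) ≠ σ` and
`E(𝔽_p) ≅ ℤ/m₁ℤ × ℤ/m₁k₁ℤ`, one has `k₁ > √p/8 - 1/2`, `m₁ < 3 p^{1/4}` and
`m₁ k₁ > p^{3/4}/√10`. -/
theorem stmt_15 (p : ℕ) [Fact p.Prime] (σ : ℕ) (hσ0 : 0 < σ)
    (hσ1 : 0 < |(σ : ℝ) - p - 1|) (hσ2 : |(σ : ℝ) - p - 1| ≤ 2 * Real.sqrt p)
    (A B α : ZMod p) (hα : ¬ IsSquare α)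
    (hΔ : (shortWeierstrass (ZMod p) A B).Δ ≠ 0)
    (hcard : Nat.card (shortWeierstrass (ZMod p) A B).Point ≠ σ)
    (hE : ∀ P : (shortWeierstrass (ZMod p) A B).Point, σ • P = 0)
    (hEt : ∀ Q : (shortWeierstrass (ZMod p) ((α ^ 2)⁻¹ * A) ((α ^ 3)⁻¹ * B)).Point,
      (2 * (p : ℤ) + 2 - (σ : ℤ)) • Q = 0)
    (m₁ k₁ : ℕ) (hm₁ : 0 < m₁) (hk₁ : 0 < k₁)
    (hiso : Nonempty
      ((shortWeierstrass (ZMod p) A B).Point ≃+ ZMod m₁ × ZMod (m₁ * k₁))) :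
    Real.sqrt p / 8 - 1 / 2 < (k₁ : ℝ) ∧
      (m₁ : ℝ) < 3 * (p : ℝ) ^ ((1 : ℝ) / 4) ∧
      (p : ℝ) ^ ((3 : ℝ) / 4) / Real.sqrt 10 < ((m₁ : ℝ) * (k₁ : ℝ)) := by
  have hp : p.Prime := Fact.out
  obtain ⟨Φ⟩ := hiso
  obtain ⟨hΔ', htw⟩ := card_twist α hα hΔ
  rw [ZMod.card] at htw
  have hp2 : p ≠ 2 := by
    rintro rfl
    exact (disc_ne hΔ).1 rfl
  have hp3 : 3 ≤ p := by have := hp.two_le; omega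
  have hN1 : Nat.card (shortWeierstrass (ZMod p) A B).Point = m₁ * (m₁ * k₁) := by
    rw [Nat.card_congr Φ.toEquiv, Nat.card_prod, Nat.card_zmod, Nat.card_zmod]
  obtain ⟨a, ha⟩ : ∃ a : ℤ, a = p + 1 - Nat.card (shortWeierstrass (ZMod p) A B).Point := ⟨_, rfl⟩
  have hfin := pt_finite hΔ'
  set E' := shortWeierstrass (ZMod p) ((α ^ 2)⁻¹ * A) ((α ^ 3)⁻¹ * B) with hE'
  have ha' : -a = p + 1 - Nat.card E'.Point := by
    have : (Nat.card E'.Point : ℤ) + Nat.card (shortWeierstrass (ZMod p) A B).Point = 2 * p + 2 := by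
      exact_mod_cast htw
    linarith
  obtain ⟨c1, c2⟩ := curve_main hΔ a (by rw [ZMod.card]; exact ha)
  obtain ⟨d1, d2⟩ := curve_main hΔ' (-a) (by rw [ZMod.card]; exact ha')
  rw [ZMod.card] at c1
  have hasse := hasse_of p hp hp2 a c1
  have hN : (m₁ * (m₁ * k₁ : ℕ) : ℤ) = p + 1 - a := by
    rw [ha, hN1]; push_cast; ring
  refine final_bounds p m₁ k₁ hp3 ?_ hm₁ hk₁ a hasse hN
  -- exponent of the first group
  have he1 : ∀ T : (shortWeierstrass (ZMod p) A B).Point, (m₁ * k₁) • T = 0 := by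
    intro T
    apply Φ.injective
    rw [map_nsmul, map_zero]
    ext
    · simp
    · rw [Prod.smul_snd, nsmul_eq_mul, ZMod.natCast_self, zero_mul]
      rfl
  have he1σ : (m₁ * k₁) ∣ σ := by
    have h := hE (Φ.symm (0, 1))
    have h' := congrArg Φ h
    rw [map_nsmul, Φ.apply_symm_apply, map_zero] at h'
    have h2 := congrArg Prod.snd h'
    simp only [Prod.smul_mk, nsmul_eq_mul, mul_one, Prod.snd_zero] at h2
    rwa [ZMod.natCast_eq_zero_iff] at h2
  -- exponent of the second group
  set f := AddMonoid.exponent E'.Point with hf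
  obtain ⟨n, hn⟩ : f ∣ Nat.card E'.Point := AddGroup.exponent_dvd_nat_card
  have hcpos : 0 < Nat.card E'.Point := Nat.card_pos
  have hfpos : 0 < f := Nat.pos_of_ne_zero (by intro h; rw [h, zero_mul] at hn; omega)
  have hnpos : 0 < n := Nat.pos_of_ne_zero (by intro h; rw [h, mul_zero] at hn; omega)
  have hfσ : (f : ℤ) ∣ 2 * p + 2 - σ := by
    rw [Int.natCast_dvd, hf]
    apply AddMonoid.exponent_dvd_of_forall_nsmul_eq_zero
    intro Q
    rw [← natCast_zsmul]
    rcases Int.natAbs_eq (2 * (p : ℤ) + 2 - σ) with h | h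
    · rw [← h, hEt]
    · have h' := hEt Q
      rw [h, neg_smul, neg_eq_zero] at h'
      exact h'
  obtain ⟨u1, -⟩ := c2 (m₁ * k₁) he1
  obtain ⟨v1, v2⟩ := d2 f (fun T => AddMonoid.exponent_nsmul_eq_zero T)
  rw [hN1] at u1
  rw [hn] at v1 v2
  have he0 : ((m₁ * k₁ : ℕ) : ℤ) ≠ 0 := by positivity
  have hf0 : (f : ℤ) ≠ 0 := by positivity
  have w1 : (m₁ : ℤ) ∣ 2 - a := by
    rw [Nat.cast_mul m₁ (m₁ * k₁), mul_comm, mul_dvd_mul_iff_left he0] at u1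
    have : (m₁ : ℤ) ∣ ((m₁ * k₁ : ℕ) : ℤ) := by push_cast; exact dvd_mul_right _ _
    refine (dvd_sub u1 this).trans (dvd_of_eq (by ring))
  have w2 : (n : ℤ) ∣ f + 2 + a := by
    rw [Nat.cast_mul, mul_dvd_mul_iff_left hf0] at v1
    exact v1.trans (dvd_of_eq (by ring))
  have w3 : (n : ℤ) ∣ f - (2 + a) := by
    rw [Nat.cast_mul, mul_dvd_mul_iff_left hf0] at v2
    exact v2.trans (dvd_of_eq (by ring))
  have hM : (n * f : ℤ) = p + 1 + a := by
    rw [hn] at ha'; push_cast at ha'; linarith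
  refine arith_main p m₁ k₁ n f hp hm₁ hk₁ hnpos hfpos a (p + 1 - σ) hasse ?_ hN hM w1 w2 w3 ?_ ?_ ?_
  · have h1 : ((σ : ℝ) - p - 1) ^ 2 ≤ 4 * p := by
      rw [← sq_abs]
      calc _ ≤ (2 * Real.sqrt p) ^ 2 := pow_le_pow_left₀ (abs_nonneg _) hσ2 2
        _ = _ := by rw [mul_pow, Real.sq_sqrt (Nat.cast_nonneg p)]; norm_num
    have h2 : ((σ : ℤ) - p - 1) ^ 2 ≤ 4 * p := by exact_mod_cast h1
    linarith
  · intro h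
    apply hcard
    have : (Nat.card (shortWeierstrass (ZMod p) A B).Point : ℤ) = σ := by linarith
    exact_mod_cast this
  · have h1 : ((m₁ * k₁ : ℕ) : ℤ) ∣ σ := by exact_mod_cast he1σ
    have h2 : ((m₁ * k₁ : ℕ) : ℤ) ∣ p + 1 - a := hN ▸ dvd_mul_left _ _
    exact (dvd_sub h1 h2).trans (dvd_of_eq (by ring))
  · have h2 : (f : ℤ) ∣ p + 1 + a := hM ▸ dvd_mul_left _ _
    exact (dvd_sub h2 hfσ).trans (dvd_of_eq (by ring))
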